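/- arXiv:math/0604224 — 2 statements merged into one kernel-verified Lean document; each statement's English description precedes it below -/
import Mathlib

section
/- Let N be a normal subgroup of G and π : G → G/N the canonical surjection. The map Res_π^{(1)} : R_𝔭(G/N,1) → R_𝔭(G,1), f ↦ (f ∘ π)·e_1^G, is (a) a split injection of 𝒪_𝔭-modules (injective with image a direct summand), and (b) an isomorphism of 𝒪_𝔭-algebras when |N| is prime to p. In particular, if |N| is prime to p, then ℓ_p(G,1) = ℓ_p(G/N,1) and ext_p^1(G,1) = ext_p^1(G/N,1). -/
open scoped TensorProduct Classical

/-! Common definitions: the character ring of a finite group, following Bonnafé,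
"On the character ring of a finite group". -/

/-- The set of characters of finite-dimensional `K`-linear representations of `G`. -/
def charSet (K G : Type u) [Field K] [Group G] : Set (G → K) :=
  {f | ∃ V : FDRep K G, f = FDRep.character V}

/-- The character ring `R(G)` of virtual characters, i.e. the subring of the `K`-algebra of
functions `G → K` generated by the characters.  Over a splitting field of characteristic zero
this is exactly the set of `ℤ`-linear combinations of irreducible characters. -/
def charRing (K G : Type u) [Field K] [Group G] : Subring (G → K) :=
  Subring.closure (charSet K G)

/-- `g` is `p`-regular if its order is prime to `p`. -/
def IsPRegular (p : ℕ) {G : Type*} [Monoid G] (g : G) : Prop :=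
  Nat.Coprime (orderOf g) p

/-- `g` is a `p`-element if its order is a power of `p`. -/
def IsPElement (p : ℕ) {G : Type*} [Monoid G] (g : G) : Prop :=
  ∃ n : ℕ, orderOf g = p ^ n

/-- The `p'`-part `g_{p'}` of an element `g` of a finite group:  writing `orderOf g = q * m'`
with `q` the `p`-part of the order, this is `g ^ (q * u)` where `u` is the inverse of
`q` modulo `m'`; it is the unique `p`-regular power of `g` such that `g * g_{p'}⁻¹` is a
`p`-element commuting with it. -/
noncomputable def pPrimePart (p : ℕ) {G : Type*} [Group G] (g : G) : G :=
  g ^ (p ^ (orderOf g).factorization p *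
      (((p : ZMod (orderOf g / p ^ (orderOf g).factorization p)) ^
        (orderOf g).factorization p)⁻¹).val)

/-- The `p'`-section `S_{p'}(C)` of the conjugacy class `C` of `g` : the set of all
`x ∈ G` whose `p'`-part lies in the class of `g`. -/
def pSection (p : ℕ) {G : Type*} [Group G] (g : G) : Set G :=
  {x | IsConj g (pPrimePart p x)}

/-- The idempotent class function `e_C` attached to the class `C` of `g`:  the characteristic
function (with values in `K`) of the `p'`-section of `C`. -/
noncomputable def eFun (p : ℕ) (K : Type*) [Field K] {G : Type*} [Group G] (g : G) : G → K :=
  fun x => if IsConj g (pPrimePart p x) then 1 else 0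

/-- The number of conjugacy classes of `G` contained in a subset `S`. -/
noncomputable def numClassesIn {G : Type*} [Group G] (S : Set G) : ℕ :=
  Nat.card {c : ConjClasses G // c.carrier ⊆ S}

/-- The image of the localization `𝒪_𝔭` in the fraction field `K`: fractions `a / b` with
`b ∉ 𝔭`. -/
def locSet (𝒪 K : Type*) [CommRing 𝒪] [Field K] [Algebra 𝒪 K] (𝔭 : Ideal 𝒪) : Set K :=
  {x | ∃ a b : 𝒪, b ∉ 𝔭 ∧ x * algebraMap 𝒪 K b = algebraMap 𝒪 K a}

/-- `𝒪_𝔭 R(G)`: the `𝒪_𝔭`-span of the character ring inside class functions `G → K`,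
realized as the subring generated by `𝒪_𝔭`-constants and characters. -/
def locCharRing (𝒪 : Type*) (K : Type u) [CommRing 𝒪] [Field K] [Algebra 𝒪 K] (𝔭 : Ideal 𝒪)
    (G : Type u) [Group G] : Subring (G → K) :=
  Subring.closure ({f | ∃ x ∈ locSet 𝒪 K 𝔭, f = Function.const G x} ∪ charSet K G)

/-- The ideal `𝔭 · 𝒪_𝔭R(G)` of `𝒪_𝔭R(G)`, generated by the constants from `𝔭`. -/
def pConstIdeal (𝒪 : Type*) (K : Type u) [CommRing 𝒪] [Field K] [Algebra 𝒪 K] (𝔭 : Ideal 𝒪)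
    (G : Type u) [Group G] : Ideal (locCharRing 𝒪 K 𝔭 G) :=
  Ideal.span {f | ∃ a ∈ 𝔭, (f : G → K) = Function.const G (algebraMap 𝒪 K a)}

/-- `kR(G) = k ⊗_ℤ R(G)`, realized through the canonical identification
`k ⊗_ℤ R(G) ≅ 𝒪_𝔭R(G) ⧸ 𝔭·𝒪_𝔭R(G)` (where `k = 𝒪/𝔭`). -/
abbrev kCharRing (𝒪 : Type*) (K : Type u) [CommRing 𝒪] [Field K] [Algebra 𝒪 K] (𝔭 : Ideal 𝒪)
    (G : Type u) [Group G] :=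
  locCharRing 𝒪 K 𝔭 G ⧸ pConstIdeal 𝒪 K 𝔭 G

/-- The ideal of `𝒪_𝔭R(G)` cutting out the block `R_𝔭(G, C)` with identity element the
idempotent `e : 𝒪_𝔭R(G)`, reduced mod `𝔭`:  the block `kR(G)·ē` is canonically the quotient
by `𝔭·𝒪_𝔭R(G) + (1 - e)·𝒪_𝔭R(G)`. -/
def blockIdeal (𝒪 : Type*) (K : Type u) [CommRing 𝒪] [Field K] [Algebra 𝒪 K] (𝔭 : Ideal 𝒪)
    (G : Type u) [Group G] (e : locCharRing 𝒪 K 𝔭 G) : Ideal (locCharRing 𝒪 K 𝔭 G) :=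
  pConstIdeal 𝒪 K 𝔭 G ⊔ Ideal.span {1 - e}

/-- The block `kR_𝔭(G, C) = kR(G)·ē_C` of `kR(G)`, as a (unital) `k`-algebra, realized as the
quotient of `𝒪_𝔭R(G)` by `𝔭·𝒪_𝔭R(G) + (1 - e_C)·𝒪_𝔭R(G)`. -/
abbrev blockAlg (𝒪 : Type*) (K : Type u) [CommRing 𝒪] [Field K] [Algebra 𝒪 K] (𝔭 : Ideal 𝒪)
    (G : Type u) [Group G] (e : locCharRing 𝒪 K 𝔭 G) :=
  locCharRing 𝒪 K 𝔭 G ⧸ blockIdeal 𝒪 K 𝔭 G e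

/-- The constants, as a ring morphism `𝒪 →+* 𝒪_𝔭R(G)`. -/
noncomputable def constRingHom (𝒪 : Type*) (K : Type u) [CommRing 𝒪] [Field K] [Algebra 𝒪 K]
    (𝔭 : Ideal 𝒪) [𝔭.IsMaximal] (G : Type u) [Group G] : 𝒪 →+* locCharRing 𝒪 K 𝔭 G where
  toFun a := ⟨Function.const G (algebraMap 𝒪 K a),
    Subring.subset_closure (Or.inl ⟨algebraMap 𝒪 K a,
      ⟨a, 1, fun h => (Ideal.ne_top_iff_one 𝔭).mp (Ideal.IsMaximal.ne_top ‹_›) h, by simp⟩, rfl⟩)⟩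
  map_one' := Subtype.ext (funext fun g => by simp)
  map_mul' a b := Subtype.ext (funext fun g => by simp)
  map_zero' := Subtype.ext (funext fun g => by simp)
  map_add' a b := Subtype.ext (funext fun g => by simp)

/-- The structural morphism giving quotients of `𝒪_𝔭R(G)` by ideals containing
`𝔭·𝒪_𝔭R(G)` (such as `kR(G)` and its blocks) their `k = 𝒪/𝔭`-algebra structure. -/
noncomputable def kScalars (𝒪 : Type*) (K : Type u) [CommRing 𝒪] [Field K] [Algebra 𝒪 K]
    (𝔭 : Ideal 𝒪) [𝔭.IsMaximal] (G : Type u) [Group G]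
    (I : Ideal (locCharRing 𝒪 K 𝔭 G)) (hI : pConstIdeal 𝒪 K 𝔭 G ≤ I) :
    (𝒪 ⧸ 𝔭) →+* (locCharRing 𝒪 K 𝔭 G ⧸ I) :=
  Ideal.Quotient.lift 𝔭 ((Ideal.Quotient.mk I).comp (constRingHom 𝒪 K 𝔭 G))
    (fun a ha => by
      simp only [RingHom.comp_apply]
      exact Ideal.Quotient.eq_zero_iff_mem.mpr (hI (Ideal.subset_span ⟨a, ha, rfl⟩)))

/-- The `k`-algebra structure morphism of the block `kR_𝔭(G, C)`. -/
noncomputable def blockScalars (𝒪 : Type*) (K : Type u) [CommRing 𝒪] [Field K] [Algebra 𝒪 K]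
    (𝔭 : Ideal 𝒪) [𝔭.IsMaximal] (G : Type u) [Group G] (e : locCharRing 𝒪 K 𝔭 G) :
    (𝒪 ⧸ 𝔭) →+* blockAlg 𝒪 K 𝔭 G e :=
  kScalars 𝒪 K 𝔭 G (blockIdeal 𝒪 K 𝔭 G e) le_sup_left

/-- The Jacobson radical of a ring. -/
noncomputable def jacRad (A : Type*) [CommRing A] : Ideal A := (⊥ : Ideal A).jacobson

/-- The Loewy length of `A`: the least `n` with `(Rad A) ^ n = 0`. -/
noncomputable def loewyLength (A : Type*) [CommRing A] : ℕ :=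
  sInf {n : ℕ | jacRad A ^ n = ⊥}

/-- `Rad A / (Rad A)²`. -/
noncomputable abbrev radQuotient (A : Type*) [CommRing A] :=
  jacRad A ⧸ (Submodule.comap (jacRad A).subtype (jacRad A ^ 2 : Ideal A))

/-- `dim_k Rad(A)/Rad(A)²`, the `k`-vector space structure being induced by a ring morphism
`k →+* A`. -/
noncomputable def extDim (k : Type*) [CommRing k] {A : Type*} [CommRing A] (φ : k →+* A) : ℕ :=
  letI : Module k (radQuotient A) := Module.compHom _ φ
  Module.finrank k (radQuotient A)

/-- `dim_k A`, the `k`-vector space structure being induced by a ring morphism `k →+* A`. -/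
noncomputable def kDim (k : Type*) [CommRing k] {A : Type*} [CommRing A] (φ : k →+* A) : ℕ :=
  letI : Module k A := Module.compHom _ φ
  Module.finrank k A

/-- `dim_k I` for an ideal `I` of `A`, the `k`-vector space structure being induced by a ring
morphism `k →+* A`. -/
noncomputable def idealKDim (k : Type*) [CommRing k] {A : Type*} [CommRing A] (φ : k →+* A)
    (I : Ideal A) : ℕ :=
  letI : Module k I := Module.compHom _ φ
  Module.finrank k I

/-- The canonical embedding of the localization `𝒪_𝔭` into the fraction field `K`. -/
noncomputable def locToK (𝒪 K : Type*) [CommRing 𝒪] [IsDomain 𝒪] [Field K] [Algebra 𝒪 K]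
    [IsFractionRing 𝒪 K] (𝔭 : Ideal 𝒪) [𝔭.IsPrime] : Localization.AtPrime 𝔭 →+* K :=
  IsLocalization.lift (M := 𝔭.primeCompl) (g := algebraMap 𝒪 K)
    (fun y => isUnit_iff_ne_zero.mpr (fun h => y.2 (by
      have h0 : (y : 𝒪) = 0 := IsFractionRing.injective 𝒪 K (by simpa using h)
      rw [h0]; exact 𝔭.zero_mem)))

/-- Class functions `G → K` as a module over the localization `𝒪_𝔭`, through the canonical
embedding `𝒪_𝔭 → K`. -/
noncomputable def locModule (𝒪 : Type*) (K : Type u) [CommRing 𝒪] [IsDomain 𝒪] [Field K]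
    [Algebra 𝒪 K] [IsFractionRing 𝒪 K] (𝔭 : Ideal 𝒪) [𝔭.IsPrime] (G : Type u) :
    Module (Localization.AtPrime 𝔭) (G → K) :=
  Module.compHom _ (locToK 𝒪 K 𝔭)

/-- The rank over `𝒪_𝔭` of the block `R_𝔭(G, C) = 𝒪_𝔭R(G)·e_C`, where `C` is the class
of `g`. -/
noncomputable def blockLocRank (p : ℕ) (𝒪 : Type*) (K : Type u) [CommRing 𝒪] [IsDomain 𝒪]
    [Field K] [Algebra 𝒪 K] [IsFractionRing 𝒪 K] (𝔭 : Ideal 𝒪) [𝔭.IsPrime]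
    (G : Type u) [Group G] (g : G) : ℕ :=
  letI := locModule 𝒪 K 𝔭 G
  Module.finrank (Localization.AtPrime 𝔭)
    (Submodule.span (Localization.AtPrime 𝔭)
      {f : G → K | f ∈ locCharRing 𝒪 K 𝔭 G ∧ f * eFun p K g = f})

section PElements

lemma isPElement_iff_exists_pow_eq_one {p : ℕ} [Fact p.Prime] {G : Type*} [Group G] {x : G} :
    IsPElement p x ↔ ∃ n : ℕ, x ^ p ^ n = 1 :=
  exists_orderOf_eq_prime_pow_iff

lemma IsPElement.map {p : ℕ} [Fact p.Prime] {G H : Type*} [Group G] [Group H] {x : G}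
    (hx : IsPElement p x) (f : G →* H) : IsPElement p (f x) := by
  obtain ⟨n, hn⟩ := isPElement_iff_exists_pow_eq_one.mp hx
  exact isPElement_iff_exists_pow_eq_one.mpr ⟨n, by rw [← map_pow, hn, map_one]⟩

lemma pPrimePart_eq_one_iff {p : ℕ} [Fact p.Prime] {G : Type*} [Group G] [Finite G] {x : G} :
    pPrimePart p x = 1 ↔ IsPElement p x := by
  have hp : p.Prime := Fact.out
  have h0 : orderOf x ≠ 0 := (orderOf_pos x).ne'
  set a := (orderOf x).factorization p with ha
  set m := orderOf x / p ^ a with hm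
  have hfac : p ^ a * m = orderOf x := Nat.ordProj_mul_ordCompl_eq_self _ _
  have hcop : Nat.Coprime p m := Nat.coprime_ordCompl hp h0
  constructor
  · intro h
    have h1 : orderOf x ∣ p ^ a * (((p : ZMod m) ^ a)⁻¹).val := orderOf_dvd_of_pow_eq_one h
    rw [← hfac] at h1
    have h2 : m ∣ (((p : ZMod m) ^ a)⁻¹).val :=
      Nat.dvd_of_mul_dvd_mul_left (pow_pos hp.pos a) h1
    have h3 : (((p : ZMod m) ^ a)⁻¹) = 0 := by
      have := (ZMod.natCast_eq_zero_iff (((p : ZMod m) ^ a)⁻¹).val m).mpr h2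
      have hm0 : NeZero m := ⟨by rintro h; rw [h, mul_zero] at hfac; exact h0 hfac.symm⟩
      rwa [ZMod.natCast_zmod_val] at this
    have h4 : ((p ^ a : ℕ) : ZMod m) * ((p ^ a : ℕ) : ZMod m)⁻¹ = 1 :=
      ZMod.coe_mul_inv_eq_one _ (hcop.pow_left a)
    rw [Nat.cast_pow, h3, mul_zero] at h4
    have h5 : m ∣ 1 := by
      rw [← ZMod.natCast_eq_zero_iff, Nat.cast_one, ← h4]
    exact ⟨a, by rw [← hfac, Nat.dvd_one.mp h5, mul_one]⟩
  · rintro ⟨n, hn⟩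
    have han : a = n := by rw [ha, hn, hp.factorization_pow, Finsupp.single_eq_same]
    have : x ^ p ^ a = 1 := by rw [han, ← hn, pow_orderOf_eq_one]
    change x ^ (p ^ a * _) = 1
    rw [pow_mul, this, one_pow]

lemma eFun_one_apply (p : ℕ) [Fact p.Prime] (K : Type*) [Field K] {G : Type*} [Group G]
    [Finite G] (x : G) : eFun p K (1 : G) x = if IsPElement p x then 1 else 0 := by
  simp only [eFun, isConj_one_right, pPrimePart_eq_one_iff]

lemma eFun_one_mul_self (p : ℕ) [Fact p.Prime] (K : Type*) [Field K] {G : Type*} [Group G]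
    [Finite G] : eFun p K (1 : G) * eFun p K (1 : G) = eFun p K (1 : G) := by
  funext x
  simp only [Pi.mul_apply, eFun_one_apply]
  split_ifs <;> simp

/-- Two `p`-elements in the same coset of a normal `p'`-subgroup are conjugate. -/
lemma IsPElement.isConj_of_mul {p : ℕ} [Fact p.Prime] {G : Type*} [Group G] {N : Subgroup G}
    [N.Normal] [Finite N] (hN : Nat.Coprime (Nat.card N) p) {x : G} {n : G} (hn : n ∈ N)
    (hx : IsPElement p x) (hy : IsPElement p (x * n)) : ∃ m : G, m * x * m⁻¹ = x * n := by
  have hp : p.Prime := Fact.out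
  obtain ⟨a, ha⟩ := isPElement_iff_exists_pow_eq_one.mp hx
  obtain ⟨b, hb⟩ := isPElement_iff_exists_pow_eq_one.mp hy
  have hmem : ∀ m ∈ N, (x * n)⁻¹ * m * x ∈ N := fun m hm => by
    have : (x * n)⁻¹ * m * x = n⁻¹ * (x⁻¹ * m * x) := by group
    rw [this]
    exact N.mul_mem (N.inv_mem hn) (by simpa using Subgroup.Normal.conj_mem ‹_› m hm x⁻¹)
  have hmem' : ∀ m ∈ N, (x * n) * m * x⁻¹ ∈ N := fun m hm => by
    have : (x * n) * m * x⁻¹ = x * (n * m) * x⁻¹ := by group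
    rw [this]
    exact Subgroup.Normal.conj_mem ‹_› _ (N.mul_mem hn hm) x
  let σ : Equiv.Perm N :=
    { toFun := fun m => ⟨_, hmem m m.2⟩
      invFun := fun m => ⟨_, hmem' m m.2⟩
      left_inv := fun m => Subtype.ext (by simp only; group)
      right_inv := fun m => Subtype.ext (by simp only; group) }
  have hσ : ∀ (k : ℕ) (m : N), ((σ ^ k) m : G) = ((x * n) ^ k)⁻¹ * m * x ^ k := by
    intro k
    induction k with
    | zero => intro m; simp
    | succ k ih =>
      intro m
      rw [pow_succ, Equiv.Perm.mul_apply, ih, pow_succ', pow_succ']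
      change _ * ((x * n)⁻¹ * m * x) * _ = _
      simp only [mul_inv_rev, mul_assoc]
  have : Fintype N := Fintype.ofFinite N
  have hcard : ¬ p ∣ Fintype.card N := by
    rw [← Nat.card_eq_fintype_card]
    exact (hp.coprime_iff_not_dvd.mp hN.symm)
  have hpow : σ ^ p ^ (a + b) = 1 := by
    ext m
    rw [hσ, pow_add, pow_mul x, ha, mul_comm, pow_mul (x * n), hb]
    simp
  obtain ⟨m, hm⟩ := Equiv.Perm.exists_fixed_point_of_prime hcard hpow
  refine ⟨m, ?_⟩
  have h : (x * n)⁻¹ * (m : G) * x = m := congrArg Subtype.val hm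
  have h' : (m : G) * x = (x * n) * m := by rw [mul_assoc, inv_mul_eq_iff_eq_mul] at h; exact h
  rw [h', mul_inv_cancel_right]

end PElements

section Characters

lemma trace_mem_charSet {K G : Type u} [Field K] [Group G] {V : Type u} [AddCommGroup V]
    [Module K V] [Module.Finite K V] (ρ : Representation K G V) :
    (fun g => LinearMap.trace K V (ρ g)) ∈ charSet K G :=
  ⟨FDRep.of ρ, rfl⟩

lemma exists_trace_of_mem_charSet {K G : Type u} [Field K] [Group G] {f : G → K}
    (hf : f ∈ charSet K G) :
    ∃ (V : Type u) (_ : AddCommGroup V) (_ : Module K V) (_ : Module.Finite K V)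
      (ρ : Representation K G V), f = fun g => LinearMap.trace K V (ρ g) := by
  obtain ⟨V, rfl⟩ := hf
  exact ⟨V, inferInstance, inferInstance, inferInstance, V.ρ, rfl⟩

lemma one_mem_charSet {K G : Type u} [Field K] [Group G] : (1 : G → K) ∈ charSet K G := by
  convert! trace_mem_charSet (Representation.trivial K G K) using 1
  funext g
  simp

lemma mul_mem_charSet {K G : Type u} [Field K] [Group G] {f g : G → K} (hf : f ∈ charSet K G)
    (hg : g ∈ charSet K G) : f * g ∈ charSet K G := by
  obtain ⟨V, _, _, _, ρ, rfl⟩ := exists_trace_of_mem_charSet hf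
  obtain ⟨W, _, _, _, σ, rfl⟩ := exists_trace_of_mem_charSet hg
  convert! trace_mem_charSet (ρ.tprod σ) using 1
  exact (Representation.char_tensor ρ σ).symm

lemma comp_mem_charSet {K G H : Type u} [Field K] [Group G] [Group H] {f : H → K}
    (hf : f ∈ charSet K H) (φ : G →* H) : (fun x => f (φ x)) ∈ charSet K G := by
  obtain ⟨V, _, _, _, ρ, rfl⟩ := exists_trace_of_mem_charSet hf
  exact trace_mem_charSet (ρ.comp φ)

lemma conj_of_mem_charSet {K G : Type u} [Field K] [Group G] {f : G → K}
    (hf : f ∈ charSet K G) (g h : G) : f (h * g * h⁻¹) = f g := by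
  obtain ⟨V, _, _, _, ρ, rfl⟩ := exists_trace_of_mem_charSet hf
  exact Representation.char_conj ρ g h

/-- The permutation character of `G` on a finite `G`-set `X`. -/
noncomputable def permChar (K G X : Type*) [Field K] [Group G] [MulAction G X] : G → K :=
  fun g => (Nat.card (MulAction.fixedBy X g) : K)

/-- The representation of `G` on the functions on a `G`-set. -/
def permRep (K G X : Type*) [Field K] [Group G] [MulAction G X] :
    Representation K G (X → K) where
  toFun g := LinearMap.funLeft K K (g⁻¹ • ·)
  map_one' := by ext; simp [LinearMap.funLeft]
  map_mul' a b := by ext; simp [LinearMap.funLeft, mul_smul]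

lemma permChar_mem_charSet (K G X : Type u) [Field K] [Group G] [MulAction G X] [Finite X] :
    permChar K G X ∈ charSet K G := by
  have : Fintype X := Fintype.ofFinite X
  convert! trace_mem_charSet (permRep K G X) using 1
  funext g
  rw [LinearMap.trace_eq_matrix_trace K (Pi.basisFun K X), Matrix.trace]
  simp only [Matrix.diag, LinearMap.toMatrix_apply, Pi.basisFun_repr, Pi.basisFun_apply, permRep,
    MonoidHom.coe_mk, OneHom.coe_mk, LinearMap.funLeft_apply, Pi.single_apply, permChar]
  rw [Finset.sum_boole, Nat.card_eq_fintype_card, Fintype.card_subtype]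
  congr 2
  ext x
  simp [eq_comm (a := x), inv_smul_eq_iff]

/-- Averaging over the cosets of a normal subgroup, from functions on `G` to functions on `G ⧸ N`.
On characters this is the operation `V ↦ V ^ N`. -/
noncomputable def cosetAverage (K : Type*) {G : Type*} [Field K] [Group G] (N : Subgroup G)
    [Fintype N] : (G → K) →ₗ[K] (G ⧸ N → K) where
  toFun f q := (Fintype.card N : K)⁻¹ * ∑ n : N, f (q.out * n)
  map_add' f g := by
    funext q
    simp [Finset.sum_add_distrib, mul_add]
  map_smul' c f := by
    funext q
    simp [← Finset.mul_sum, mul_left_comm]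

lemma cosetAverage_mk {K G : Type*} [Field K] [Group G] (N : Subgroup G) [Fintype N] (f : G → K)
    (x : G) : cosetAverage K N f (QuotientGroup.mk x) =
      (Fintype.card N : K)⁻¹ * ∑ n : N, f (x * n) := by
  obtain ⟨m, hm⟩ := QuotientGroup.mk_out_eq_mul N x
  change (Fintype.card N : K)⁻¹ * ∑ n : N, f ((QuotientGroup.mk x : G ⧸ N).out * n) = _
  rw [hm]
  congr 1
  refine Fintype.sum_equiv (Equiv.mulLeft m) _ _ fun n => ?_
  simp [mul_assoc]

lemma cosetAverage_mul_comp_mk {K G : Type*} [Field K] [Group G] (N : Subgroup G) [Fintype N]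
    (u : G ⧸ N → K) (f : G → K) :
    cosetAverage K N ((fun x => u (QuotientGroup.mk x)) * f) = u * cosetAverage K N f := by
  funext q
  obtain ⟨x, rfl⟩ := QuotientGroup.mk_surjective q
  rw [Pi.mul_apply, cosetAverage_mk, cosetAverage_mk]
  simp only [Pi.mul_apply, QuotientGroup.mk_mul_of_mem x (Subtype.prop _)]
  rw [← Finset.mul_sum, mul_left_comm]

lemma cosetAverage_mem_charSet {K G : Type u} [Field K] [CharZero K] [Group G] (N : Subgroup G)
    [N.Normal] [Fintype N] {f : G → K} (hf : f ∈ charSet K G) :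
    cosetAverage K N f ∈ charSet K (G ⧸ N) := by
  obtain ⟨V, _, _, _, ρ, rfl⟩ := exists_trace_of_mem_charSet hf
  have hinv : Invertible (Fintype.card N : K) :=
    invertibleOfNonzero (Nat.cast_ne_zero.mpr Fintype.card_ne_zero)
  convert! trace_mem_charSet (ρ.quotientToInvariants N) using 1
  funext q
  obtain ⟨x, rfl⟩ := QuotientGroup.mk_surjective q
  rw [cosetAverage_mk]
  set σ : Representation K N V := ρ.comp N.subtype with hσ
  have hav : ∀ v, σ.averageMap v = (Fintype.card N : K)⁻¹ • ∑ n : N, ρ n v := by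
    intro v
    simp [hσ, GroupAlgebra.average, Representation.averageMap]
  have hmem : ∀ v ∈ σ.invariants, ρ x v ∈ σ.invariants := by
    intro v hv n
    have hn : x⁻¹ * (n : G) * x ∈ N := by
      simpa using Subgroup.Normal.conj_mem ‹N.Normal› n n.2 x⁻¹
    have h2 : ρ (x⁻¹ * n * x) v = v := hv ⟨_, hn⟩
    change ρ n (ρ x v) = ρ x v
    conv_rhs => rw [← h2]
    rw [← Module.End.mul_apply, ← Module.End.mul_apply, ← map_mul, ← map_mul]
    congr 2
    group
  have htr := LinearMap.trace_restrict_eq_of_forall_mem (R := K) σ.invariants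
    (ρ x ∘ₗ σ.averageMap) (fun v => hmem _ (σ.averageMap_invariant v))
  have hsum : ρ x ∘ₗ σ.averageMap = (Fintype.card N : K)⁻¹ • ∑ n : N, ρ (x * n) := by
    ext v
    simp only [LinearMap.comp_apply, hav]
    simp [map_sum]
  rw [← map_sum, ← smul_eq_mul, ← map_smul, ← hsum, ← htr]
  congr 1
  ext v
  change ρ x (σ.averageMap v) = ρ x v
  rw [σ.averageMap_id v v.2]

end Characters

section CosetCounting

lemma card_fixedBy_quotient_mul_card {G : Type*} [Group G] [Finite G] (H : Subgroup G) (g : G) :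
    Nat.card (MulAction.fixedBy (G ⧸ H) g) * Nat.card H =
      Nat.card {h : G // h⁻¹ * g * h ∈ H} := by
  rw [mul_comm, ← QuotientGroup.card_preimage_mk H (MulAction.fixedBy (G ⧸ H) g)]
  refine Nat.card_congr (Equiv.subtypeEquivRight fun h => ?_)
  rw [Set.mem_preimage, MulAction.mem_fixedBy, eq_comm]
  change (QuotientGroup.mk h : G ⧸ H) = QuotientGroup.mk (g * h) ↔ _
  rw [QuotientGroup.eq, mul_assoc]

lemma card_mul_mem_eq_card_subgroupOf {G : Type*} [Group G] {N P : Subgroup G} [N.Normal]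
    {x h : G} (hx : (QuotientGroup.mk (h⁻¹ * x * h) : G ⧸ N) ∈ P.map (QuotientGroup.mk' N)) :
    Nat.card {n : N // h⁻¹ * (x * n) * h ∈ P} = Nat.card (N.subgroupOf P) := by
  obtain ⟨q, hq, hqx⟩ := hx
  have h1 : (h⁻¹ * x * h)⁻¹ * q ∈ N := by
    rw [← QuotientGroup.eq]; exact hqx.symm
  have hc : ∀ n ∈ N, ∀ g : G, g⁻¹ * n * g ∈ N := fun n hn g => by
    simpa using Subgroup.Normal.conj_mem ‹N.Normal› n hn g⁻¹
  have hc' : ∀ n ∈ N, ∀ g : G, g * n * g⁻¹ ∈ N := fun n hn g =>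
    Subgroup.Normal.conj_mem ‹N.Normal› n hn g
  refine Nat.card_congr
    { toFun := fun n => ⟨⟨q⁻¹ * (h⁻¹ * (x * n.1) * h), P.mul_mem (P.inv_mem hq) n.2⟩, ?_⟩
      invFun := fun m => ⟨⟨x⁻¹ * (h * (q * m) * h⁻¹), ?_⟩, ?_⟩
      left_inv := fun n => ?_
      right_inv := fun m => ?_ }
  · change q⁻¹ * (h⁻¹ * (x * n.1) * h) ∈ N
    have : q⁻¹ * (h⁻¹ * (x * n.1) * h) = ((h⁻¹ * x * h)⁻¹ * q)⁻¹ * (h⁻¹ * n.1 * h) := by group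
    rw [this]
    exact N.mul_mem (N.inv_mem h1) (hc _ n.1.2 _)
  · have : x⁻¹ * (h * (q * m.1) * h⁻¹) = h * (((h⁻¹ * x * h)⁻¹ * q) * m.1) * h⁻¹ := by group
    rw [this]
    exact hc' _ (N.mul_mem h1 m.2) _
  · have : h⁻¹ * (x * (x⁻¹ * (h * (q * m.1) * h⁻¹))) * h = q * m.1 := by group
    rw [this]
    exact P.mul_mem hq m.1.2
  · ext
    simp only
    group
  · ext
    simp only
    group

lemma card_mul_mem_eq_zero {G : Type*} [Group G] {N P : Subgroup G} [N.Normal]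
    {x h : G} (hx : (QuotientGroup.mk (h⁻¹ * x * h) : G ⧸ N) ∉ P.map (QuotientGroup.mk' N)) :
    Nat.card {n : N // h⁻¹ * (x * n) * h ∈ P} = 0 := by
  have : IsEmpty {n : N // h⁻¹ * (x * n) * h ∈ P} := by
    refine ⟨fun n => hx ⟨_, n.2, ?_⟩⟩
    have : h⁻¹ * (x * n.1) * h = h⁻¹ * x * h * (h⁻¹ * n.1 * h) := by group
    rw [this, QuotientGroup.mk'_apply]
    refine QuotientGroup.mk_mul_of_mem _ ?_
    simpa using Subgroup.Normal.conj_mem ‹N.Normal› n.1 n.1.2 h⁻¹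
  exact Nat.card_of_isEmpty

lemma card_subgroupOf_mul_card_map {G : Type*} [Group G] (N P : Subgroup G) [N.Normal] :
    Nat.card (N.subgroupOf P) * Nat.card (P.map (QuotientGroup.mk' N)) = Nat.card P := by
  rw [← Subgroup.card_mul_index (N.subgroupOf P)]
  congr 1
  have := Subgroup.relIndex_ker (QuotientGroup.mk' N) (K := P)
  rw [QuotientGroup.ker_mk'] at this
  exact this.symm

lemma sum_card_fixedBy_mul {G : Type*} [Group G] [Finite G] (N P : Subgroup G) [N.Normal]
    [Fintype N] (x : G) :
    ∑ n : N, Nat.card (MulAction.fixedBy (G ⧸ P) (x * n)) =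
      Nat.card N * Nat.card (MulAction.fixedBy ((G ⧸ N) ⧸ P.map (QuotientGroup.mk' N))
        (QuotientGroup.mk x : G ⧸ N)) := by
  have : Fintype G := Fintype.ofFinite G
  refine Nat.eq_of_mul_eq_mul_right (Nat.card_pos (α := P)) ?_
  set Q := P.map (QuotientGroup.mk' N)
  have hcomm : ∑ n : N, Nat.card {h : G // h⁻¹ * (x * n) * h ∈ P} =
      ∑ h : G, Nat.card {n : N // h⁻¹ * (x * n) * h ∈ P} := by
    simp only [Nat.card_eq_fintype_card, Fintype.card_subtype, Finset.card_filter]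
    exact Finset.sum_comm
  have hfib : ∀ h : G, Nat.card {n : N // h⁻¹ * (x * n) * h ∈ P} =
      if (QuotientGroup.mk (h⁻¹ * x * h) : G ⧸ N) ∈ Q then Nat.card (N.subgroupOf P) else 0 := by
    intro h
    split_ifs with hQ
    · exact card_mul_mem_eq_card_subgroupOf hQ
    · exact card_mul_mem_eq_zero hQ
  have hpre : (Finset.univ.filter fun h : G => (QuotientGroup.mk (h⁻¹ * x * h) : G ⧸ N) ∈ Q).card =
      Nat.card N * Nat.card {h : G ⧸ N // h⁻¹ * (QuotientGroup.mk x : G ⧸ N) * h ∈ Q} := by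
    have := QuotientGroup.card_preimage_mk N
      {h : G ⧸ N | h⁻¹ * (QuotientGroup.mk x : G ⧸ N) * h ∈ Q}
    rw [Set.coe_ofPred] at this
    rw [← this, ← Fintype.card_subtype, ← Nat.card_eq_fintype_card]
    rfl
  rw [Finset.sum_mul]
  simp only [card_fixedBy_quotient_mul_card P]
  rw [hcomm]
  simp only [hfib]
  rw [Finset.sum_ite, Finset.sum_const_zero, add_zero, Finset.sum_const, hpre,
    ← card_fixedBy_quotient_mul_card, ← card_subgroupOf_mul_card_map N P, smul_eq_mul]
  ring

lemma cosetAverage_permChar {K G : Type*} [Field K] [CharZero K] [Group G] [Finite G]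
    (N P : Subgroup G) [N.Normal] [Fintype N] :
    cosetAverage K N (permChar K G (G ⧸ P)) =
      permChar K (G ⧸ N) ((G ⧸ N) ⧸ P.map (QuotientGroup.mk' N)) := by
  funext q
  obtain ⟨x, rfl⟩ := QuotientGroup.mk_surjective q
  have h0 : (Fintype.card N : K) ≠ 0 := Nat.cast_ne_zero.mpr Fintype.card_ne_zero
  rw [cosetAverage_mk, inv_mul_eq_iff_eq_mul₀ h0]
  simp only [permChar]
  rw [← Nat.cast_sum, sum_card_fixedBy_mul, Nat.cast_mul, Nat.card_eq_fintype_card]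

/-- A `p`-element has, modulo `p`, as many fixed points as there are points. -/
lemma IsPElement.card_fixedBy_modEq {p : ℕ} [Fact p.Prime] {G X : Type*} [Group G]
    [MulAction G X] [Finite X] {g : G} (hg : IsPElement p g) :
    Nat.card X ≡ Nat.card (MulAction.fixedBy X g) [MOD p] := by
  obtain ⟨n, hn⟩ := isPElement_iff_exists_pow_eq_one.mp hg
  have : Fintype X := Fintype.ofFinite X
  let f : Function.End X := MulAction.toEndHom g
  have hf : f ^ p ^ n = 1 := by
    change (MulAction.toEndHom g) ^ p ^ n = 1
    rw [← map_pow, hn, map_one]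
  have := Equiv.Perm.card_fixedPoints_modEq hf
  simp only [Nat.card_eq_fintype_card]
  convert! this using 1

lemma IsPElement.not_dvd_card_fixedBy {p : ℕ} [Fact p.Prime] {G : Type*} [Group G] [Finite G]
    {H : Subgroup G} (hH : ¬ p ∣ H.index) {g : G} (hg : IsPElement p g) :
    ¬ p ∣ Nat.card (MulAction.fixedBy (G ⧸ H) g) := by
  rw [← (hg.card_fixedBy_modEq (X := G ⧸ H)).dvd_iff dvd_rfl]
  exact hH

lemma permChar_quotient_eq_zero {p : ℕ} [Fact p.Prime] {K G : Type*} [Field K] [Group G]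
    {P : Subgroup G} (hP : IsPGroup p P) {g : G} (hg : ¬ IsPElement p g) :
    permChar K G (G ⧸ P) g = 0 := by
  have : IsEmpty (MulAction.fixedBy (G ⧸ P) g) := by
    refine ⟨fun ⟨y, hy⟩ => hg ?_⟩
    obtain ⟨h, rfl⟩ := QuotientGroup.mk_surjective y
    have h1 : (QuotientGroup.mk h : G ⧸ P) = QuotientGroup.mk (g * h) := hy.symm
    rw [QuotientGroup.eq] at h1
    obtain ⟨n, hn⟩ := hP ⟨_, h1⟩
    have h2 : (h⁻¹ * (g * h)) ^ p ^ n = 1 := congrArg Subtype.val hn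
    have h3 : h⁻¹ * (g * h) = h⁻¹ * g * h⁻¹⁻¹ := by group
    rw [h3, conj_pow, conj_eq_one_iff] at h2
    exact isPElement_iff_exists_pow_eq_one.mpr ⟨n, h2⟩
  simp [permChar]

end CosetCounting

section LocCharRing

lemma locSet_one_mem (𝒪 K : Type*) [CommRing 𝒪] [Field K] [Algebra 𝒪 K] (𝔭 : Ideal 𝒪)
    [𝔭.IsPrime] : (1 : K) ∈ locSet 𝒪 K 𝔭 :=
  ⟨1, 1, (Ideal.ne_top_iff_one 𝔭).mp (Ideal.IsPrime.ne_top ‹_›), by simp⟩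

lemma locSet_mul_mem {𝒪 K : Type*} [CommRing 𝒪] [Field K] [Algebra 𝒪 K] {𝔭 : Ideal 𝒪}
    [𝔭.IsPrime] {x y : K} (hx : x ∈ locSet 𝒪 K 𝔭) (hy : y ∈ locSet 𝒪 K 𝔭) :
    x * y ∈ locSet 𝒪 K 𝔭 := by
  obtain ⟨a, b, hb, hab⟩ := hx
  obtain ⟨c, d, hd, hcd⟩ := hy
  refine ⟨a * c, b * d, fun h => (Ideal.IsPrime.mem_or_mem ‹_› h).elim hb hd, ?_⟩
  rw [map_mul, map_mul, ← hab, ← hcd]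
  ring

lemma const_mem_locCharRing {𝒪 : Type*} {K G : Type u} [CommRing 𝒪] [Field K] [Algebra 𝒪 K]
    {𝔭 : Ideal 𝒪} [Group G] {x : K} (hx : x ∈ locSet 𝒪 K 𝔭) :
    Function.const G x ∈ locCharRing 𝒪 K 𝔭 G :=
  Subring.subset_closure (Or.inl ⟨x, hx, rfl⟩)

lemma charSet_subset_locCharRing {𝒪 : Type*} {K G : Type u} [CommRing 𝒪] [Field K]
    [Algebra 𝒪 K] {𝔭 : Ideal 𝒪} [Group G] {f : G → K} (hf : f ∈ charSet K G) :
    f ∈ locCharRing 𝒪 K 𝔭 G :=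
  Subring.subset_closure (Or.inr hf)

lemma smul_mem_locCharRing {𝒪 : Type*} {K G : Type u} [CommRing 𝒪] [Field K] [Algebra 𝒪 K]
    {𝔭 : Ideal 𝒪} [Group G] {x : K} (hx : x ∈ locSet 𝒪 K 𝔭) {f : G → K}
    (hf : f ∈ locCharRing 𝒪 K 𝔭 G) : x • f ∈ locCharRing 𝒪 K 𝔭 G :=
  Subring.mul_mem _ (const_mem_locCharRing hx) hf

/-- `𝒪_𝔭R(G)` is additively generated by the multiples of characters by elements of `𝒪_𝔭`. -/
lemma locCharRing_induction {𝒪 : Type*} {K G : Type u} [CommRing 𝒪] [Field K] [Algebra 𝒪 K]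
    {𝔭 : Ideal 𝒪} [𝔭.IsPrime] [Group G] {motive : (G → K) → Prop}
    (smul : ∀ x ∈ locSet 𝒪 K 𝔭, ∀ χ ∈ charSet K G, motive (x • χ)) (zero : motive 0)
    (add : ∀ f g, motive f → motive g → motive (f + g)) (neg : ∀ f, motive f → motive (-f))
    {f : G → K} (hf : f ∈ locCharRing 𝒪 K 𝔭 G) : motive f := by
  let M : Submonoid (G → K) :=
    { carrier := {f | ∃ x ∈ locSet 𝒪 K 𝔭, ∃ χ ∈ charSet K G, f = x • χ}
      one_mem' := ⟨1, locSet_one_mem 𝒪 K 𝔭, 1, one_mem_charSet, (one_smul _ _).symm⟩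
      mul_mem' := by
        rintro _ _ ⟨x, hx, χ, hχ, rfl⟩ ⟨y, hy, ψ, hψ, rfl⟩
        exact ⟨x * y, locSet_mul_mem hx hy, χ * ψ, mul_mem_charSet hχ hψ, smul_mul_smul_comm ..⟩ }
  have hM : Submonoid.closure ({f | ∃ x ∈ locSet 𝒪 K 𝔭, f = Function.const G x} ∪ charSet K G)
      ≤ M := by
    rw [Submonoid.closure_le]
    rintro _ (⟨x, hx, rfl⟩ | hχ)
    · exact ⟨x, hx, 1, one_mem_charSet, by ext; simp⟩
    · exact ⟨1, locSet_one_mem 𝒪 K 𝔭, _, hχ, (one_smul _ _).symm⟩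
  rw [locCharRing, Subring.mem_closure_iff] at hf
  induction hf using AddSubgroup.closure_induction with
  | mem f hf =>
    obtain ⟨x, hx, χ, hχ, rfl⟩ := hM hf
    exact smul x hx χ hχ
  | zero => exact zero
  | add f g _ _ hf hg => exact add f g hf hg
  | neg f _ hf => exact neg f hf

lemma comp_mem_locCharRing {𝒪 : Type*} {K G H : Type u} [CommRing 𝒪] [Field K] [Algebra 𝒪 K]
    {𝔭 : Ideal 𝒪} [𝔭.IsPrime] [Group G] [Group H] (φ : G →* H) {f : H → K}
    (hf : f ∈ locCharRing 𝒪 K 𝔭 H) : (fun x => f (φ x)) ∈ locCharRing 𝒪 K 𝔭 G := by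
  refine locCharRing_induction (motive := fun f => (fun x => f (φ x)) ∈ locCharRing 𝒪 K 𝔭 G)
    (fun x hx χ hχ => ?_) ?_ (fun f g hf hg => ?_) (fun f hf => ?_) hf
  · exact smul_mem_locCharRing hx (charSet_subset_locCharRing (comp_mem_charSet hχ φ))
  · exact Subring.zero_mem _
  · exact Subring.add_mem _ hf hg
  · exact Subring.neg_mem _ hf

lemma cosetAverage_mem_locCharRing {𝒪 : Type*} {K G : Type u} [CommRing 𝒪] [Field K]
    [CharZero K] [Algebra 𝒪 K] {𝔭 : Ideal 𝒪} [𝔭.IsPrime] [Group G] (N : Subgroup G) [N.Normal]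
    [Fintype N] {f : G → K} (hf : f ∈ locCharRing 𝒪 K 𝔭 G) :
    cosetAverage K N f ∈ locCharRing 𝒪 K 𝔭 (G ⧸ N) := by
  refine locCharRing_induction
    (motive := fun f => cosetAverage K N f ∈ locCharRing 𝒪 K 𝔭 (G ⧸ N))
    (fun x hx χ hχ => ?_) ?_ (fun f g hf hg => ?_) (fun f hf => ?_) hf
  · rw [map_smul]
    exact smul_mem_locCharRing hx (charSet_subset_locCharRing (cosetAverage_mem_charSet N hχ))
  · rw [map_zero]; exact Subring.zero_mem _
  · rw [map_add]; exact Subring.add_mem _ hf hg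
  · rw [map_neg]; exact Subring.neg_mem _ hf

lemma conj_of_mem_locCharRing {𝒪 : Type*} {K G : Type u} [CommRing 𝒪] [Field K] [Algebra 𝒪 K]
    {𝔭 : Ideal 𝒪} [𝔭.IsPrime] [Group G] {f : G → K} (hf : f ∈ locCharRing 𝒪 K 𝔭 G) (g h : G) :
    f (h * g * h⁻¹) = f g := by
  refine locCharRing_induction (motive := fun f => f (h * g * h⁻¹) = f g)
    (fun x hx χ hχ => ?_) rfl (fun f f' hf hf' => ?_) (fun f hf => ?_) hf
  · simp only [Pi.smul_apply, conj_of_mem_charSet hχ]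
  · simp only [Pi.add_apply, hf, hf']
  · simp only [Pi.neg_apply, hf]

lemma intCast_notMem_of_not_dvd {𝒪 : Type*} [CommRing 𝒪] {𝔭 : Ideal 𝒪} [𝔭.IsPrime] {p : ℕ}
    [Fact p.Prime] (hp : (p : 𝒪) ∈ 𝔭) {n : ℤ} (hn : ¬ (p : ℤ) ∣ n) : (n : 𝒪) ∉ 𝔭 := by
  intro h
  obtain ⟨a, b, hab⟩ := ((Nat.prime_iff_prime_int.mp Fact.out).coprime_iff_not_dvd.mpr hn)
  have h1 : (a : 𝒪) * p + b * n = 1 := by exact_mod_cast congrArg (Int.cast (R := 𝒪)) hab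
  exact (Ideal.ne_top_iff_one 𝔭).mp (Ideal.IsPrime.ne_top ‹_›)
    (h1 ▸ 𝔭.add_mem (𝔭.mul_mem_left _ hp) (𝔭.mul_mem_left _ h))

/-- An element of `𝒪_𝔭R(G)` whose values on the support of an idempotent `e` are integers prime
to `p` is invertible in the block cut out by `e`. -/
lemma exists_inverse_of_not_dvd {𝒪 : Type*} {K G : Type u} [CommRing 𝒪] [Field K] [CharZero K]
    [Algebra 𝒪 K] {𝔭 : Ideal 𝒪} [𝔭.IsPrime] [Group G] [Finite G] {p : ℕ} [Fact p.Prime]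
    (hp : (p : 𝒪) ∈ 𝔭) {t e : G → K} (ht : t ∈ locCharRing 𝒪 K 𝔭 G)
    (he : e ∈ locCharRing 𝒪 K 𝔭 G)
    (h : ∀ x, e x = 0 ∨ e x = 1 ∧ ∃ n : ℤ, t x = n ∧ ¬ (p : ℤ) ∣ n) :
    ∃ w ∈ locCharRing 𝒪 K 𝔭 G, w * t = e ∧ w * e = w := by
  have hpZ : Prime (p : ℤ) := Nat.prime_iff_prime_int.mp Fact.out
  have key : ∀ S : Finset G, ∃ v ∈ locCharRing 𝒪 K 𝔭 G, ∃ c : ℤ, ¬ (p : ℤ) ∣ c ∧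
      ∀ x ∈ S, e x * (c - t x * v x) = 0 := by
    intro S
    induction S using Finset.induction_on with
    | empty => exact ⟨0, Subring.zero_mem _, 1, hpZ.not_dvd_one, by simp⟩
    | insert y S _ ih =>
      obtain ⟨v, hv, c, hc, hS⟩ := ih
      rcases h y with hy | ⟨hy, n, hn, hpn⟩
      · refine ⟨v, hv, c, hc, fun x hx => ?_⟩
        rcases Finset.mem_insert.mp hx with rfl | hx
        · rw [hy, zero_mul]
        · exact hS x hx
      · refine ⟨c + n * v - t * v, ?_, c * n, hpZ.not_dvd_mul hc hpn, fun x hx => ?_⟩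
        · refine Subring.sub_mem _ (Subring.add_mem _ (intCast_mem _ c)
            (Subring.mul_mem _ (intCast_mem _ n) hv)) (Subring.mul_mem _ ht hv)
        · have hprod : e x * (((c * n : ℤ) : K) - t x * ((c + n * v - t * v : G → K) x)) =
              e x * (c - t x * v x) * (n - t x) := by
            simp only [Pi.sub_apply, Pi.add_apply, Pi.mul_apply, Pi.intCast_apply, Int.cast_mul]
            ring
          rw [hprod]
          rcases Finset.mem_insert.mp hx with rfl | hx
          · rw [hn, sub_self, mul_zero]
          · rw [hS x hx, zero_mul]
  have : Fintype G := Fintype.ofFinite G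
  obtain ⟨v, hv, c, hc, hS⟩ := key Finset.univ
  have hc0 : (c : K) ≠ 0 := by
    rintro h0
    rw [Int.cast_eq_zero] at h0
    exact hc (h0 ▸ dvd_zero _)
  have hcinv : (c : K)⁻¹ ∈ locSet 𝒪 K 𝔭 :=
    ⟨1, c, intCast_notMem_of_not_dvd hp hc, by rw [map_intCast, inv_mul_cancel₀ hc0, map_one]⟩
  refine ⟨(c : K)⁻¹ • (e * v), smul_mem_locCharRing hcinv (Subring.mul_mem _ he hv), ?_, ?_⟩
  · funext x
    have := hS x (Finset.mem_univ x)
    simp only [Pi.mul_apply, Pi.smul_apply, smul_eq_mul]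
    rw [mul_assoc, inv_mul_eq_iff_eq_mul₀ hc0]
    linear_combination -this
  · funext x
    simp only [Pi.mul_apply, Pi.smul_apply, smul_eq_mul]
    rcases h x with hx | ⟨hx, -⟩ <;> simp [hx]

/-- The retraction of inflation from `G ⧸ N` to `G`, between principal blocks. -/
lemma exists_inflation_retraction {𝒪 : Type*} {K G : Type u} [CommRing 𝒪] [Field K] [CharZero K]
    [Algebra 𝒪 K] {𝔭 : Ideal 𝒪} [𝔭.IsPrime] [Group G] [Finite G] {p : ℕ} [Fact p.Prime]
    (hp : (p : 𝒪) ∈ 𝔭) (N : Subgroup G) [N.Normal]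
    (he : eFun p K (1 : G ⧸ N) ∈ locCharRing 𝒪 K 𝔭 (G ⧸ N)) :
    ∃ r : (G → K) →ₗ[K] (G ⧸ N → K),
      (∀ f ∈ locCharRing 𝒪 K 𝔭 G, r f ∈ locCharRing 𝒪 K 𝔭 (G ⧸ N)) ∧
      (∀ f, r f * eFun p K (1 : G ⧸ N) = r f) ∧
      (∀ u f, r ((fun x => u (QuotientGroup.mk x)) * f) = u * r f) ∧
      (∀ f, r (f * eFun p K (1 : G)) = r f) ∧
      r 1 = eFun p K (1 : G ⧸ N) ∧
      (Nat.Coprime (Nat.card N) p → ∀ f ∈ locCharRing 𝒪 K 𝔭 G,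
        (fun x : G => r f (QuotientGroup.mk x)) * eFun p K (1 : G) = f * eFun p K (1 : G)) := by
  have : Fintype N := Fintype.ofFinite N
  obtain ⟨P⟩ : Nonempty (Sylow p G) := inferInstance
  set π := permChar K G (G ⧸ (P : Subgroup G)) with hπ
  have hπmem : π ∈ locCharRing 𝒪 K 𝔭 G :=
    charSet_subset_locCharRing (permChar_mem_charSet K G _)
  set t := cosetAverage K N π with ht
  have htmem : t ∈ locCharRing 𝒪 K 𝔭 (G ⧸ N) := cosetAverage_mem_locCharRing N hπmem
  have hindex : ¬ p ∣ ((P : Subgroup G).map (QuotientGroup.mk' N)).index := fun hd =>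
    P.not_dvd_index (hd.trans
      (Subgroup.index_map_dvd _ (QuotientGroup.mk'_surjective N)))
  obtain ⟨w, hw, hwt, hwe⟩ := exists_inverse_of_not_dvd hp htmem he (fun q => by
    rw [eFun_one_apply]
    by_cases hq : IsPElement p q
    · refine Or.inr ⟨if_pos hq, (Nat.card (MulAction.fixedBy
        ((G ⧸ N) ⧸ (P : Subgroup G).map (QuotientGroup.mk' N)) q) : ℕ), ?_, ?_⟩
      · rw [ht, hπ, cosetAverage_permChar, permChar, Int.cast_natCast]
      · exact Int.natCast_dvd_natCast.not.mpr (hq.not_dvd_card_fixedBy hindex)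
    · exact Or.inl (if_neg hq))
  have hπe : eFun p K (1 : G) * π = π := by
    funext x
    rw [Pi.mul_apply, eFun_one_apply]
    split_ifs with hx
    · rw [one_mul]
    · rw [zero_mul, hπ, permChar_quotient_eq_zero P.isPGroup' hx]
  have hr : ∀ f, (LinearMap.mulLeft K w ∘ₗ cosetAverage K N ∘ₗ LinearMap.mulRight K π) f =
      w * cosetAverage K N (f * π) := fun f => rfl
  refine ⟨LinearMap.mulLeft K w ∘ₗ cosetAverage K N ∘ₗ LinearMap.mulRight K π,
    fun f hf => ?_, fun f => ?_, fun u f => ?_, fun f => ?_, ?_, fun hN f hf => ?_⟩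
  · exact Subring.mul_mem _ hw (cosetAverage_mem_locCharRing N (Subring.mul_mem _ hf hπmem))
  · rw [hr, mul_right_comm, hwe]
  · rw [hr, hr, mul_assoc, cosetAverage_mul_comp_mk, mul_left_comm]
  · rw [hr, hr, mul_assoc, hπe]
  · rw [hr, one_mul, hwt]
  · funext x
    simp only [Pi.mul_apply, eFun_one_apply, hr]
    split_ifs with hx
    · have hconst : ∀ n : N, (f * π) (x * n) = f x * π (x * n) := by
        intro n
        by_cases hn : IsPElement p (x * n)
        · obtain ⟨m, hm⟩ := hx.isConj_of_mul hN n.2 hn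
          rw [Pi.mul_apply, ← hm, conj_of_mem_locCharRing hf]
        · rw [Pi.mul_apply, hπ, permChar_quotient_eq_zero P.isPGroup' hn, mul_zero, mul_zero]
      have h1 : w (QuotientGroup.mk x) * t (QuotientGroup.mk x) = 1 := by
        have := congrFun hwt (QuotientGroup.mk x)
        rwa [eFun_one_apply, if_pos (show IsPElement p (x : G ⧸ N) from
          hx.map (QuotientGroup.mk' N))] at this
      rw [ht, cosetAverage_mk] at h1
      rw [cosetAverage_mk]
      simp only [hconst]
      rw [← Finset.mul_sum]
      linear_combination f x * h1
    · rw [mul_zero, mul_zero]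

end LocCharRing

section RingInvariants

lemma map_jacRad {A B : Type*} [CommRing A] [CommRing B] (e : A ≃+* B) :
    (jacRad A).map (e : A →+* B) = jacRad B := by
  rw [jacRad, jacRad, Ideal.map_jacobson_of_bijective (f := (e : A →+* B)) e.bijective,
    Ideal.map_bot]

lemma map_mem_jacRad_pow_iff {A B : Type*} [CommRing A] [CommRing B] (e : A ≃+* B) (n : ℕ)
    (x : A) : e x ∈ jacRad B ^ n ↔ x ∈ jacRad A ^ n := by
  rw [← map_jacRad e, ← Ideal.map_pow]
  refine ⟨fun h => ?_, fun h => Ideal.mem_map_of_mem (e : A →+* B) h⟩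
  obtain ⟨y, hy, hyx⟩ := (Ideal.mem_map_iff_of_surjective (e : A →+* B) e.surjective).mp h
  rwa [← e.injective hyx]

lemma loewyLength_congr {A B : Type*} [CommRing A] [CommRing B] (e : A ≃+* B) :
    loewyLength A = loewyLength B := by
  unfold loewyLength
  congr 1
  ext n
  simp only [Set.mem_ofPred_eq, Submodule.eq_bot_iff]
  constructor
  · intro h y hy
    obtain ⟨x, rfl⟩ := e.surjective y
    rw [h x ((map_mem_jacRad_pow_iff e n x).mp hy), map_zero]
  · intro h x hx
    exact (map_eq_zero_iff e e.injective).mp (h _ ((map_mem_jacRad_pow_iff e n x).mpr hx))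

lemma extDim_congr {k A B : Type*} [CommRing k] [CommRing A] [CommRing B] (e : A ≃+* B)
    {φ : k →+* A} {ψ : k →+* B} (h : ∀ c, e (φ c) = ψ c) : extDim k φ = extDim k ψ := by
  have hJ : ∀ x : A, e x ∈ jacRad B ↔ x ∈ jacRad A := fun x => by
    simpa only [pow_one] using map_mem_jacRad_pow_iff e 1 x
  let f : jacRad A →ₛₗ[(e : A →+* B)] jacRad B :=
    { toFun := fun x => ⟨e x, (hJ x).mpr x.2⟩
      map_add' := fun x y => Subtype.ext (map_add e _ _)
      map_smul' := fun a x => Subtype.ext (map_mul e _ _) }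
  let F : radQuotient A →ₛₗ[(e : A →+* B)] radQuotient B :=
    Submodule.mapQ _ _ f (fun x hx => (map_mem_jacRad_pow_iff e 2 x).mpr hx)
  have hF : Function.Bijective F := by
    constructor
    · rw [injective_iff_map_eq_zero]
      intro x hx
      obtain ⟨x, rfl⟩ := Submodule.Quotient.mk_surjective _ x
      have h1 : (Submodule.Quotient.mk (f x) : radQuotient B) = 0 := hx
      rw [Submodule.Quotient.mk_eq_zero] at h1 ⊢
      exact (map_mem_jacRad_pow_iff e 2 x).mp h1
    · intro y
      obtain ⟨⟨y, hy⟩, rfl⟩ := Submodule.Quotient.mk_surjective _ y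
      obtain ⟨x, rfl⟩ := e.surjective y
      exact ⟨Submodule.Quotient.mk ⟨x, (hJ x).mp hy⟩, rfl⟩
  unfold extDim
  let _ : Module k (radQuotient A) := Module.compHom _ φ
  let _ : Module k (radQuotient B) := Module.compHom _ ψ
  let L : radQuotient A →ₗ[k] radQuotient B :=
    { toFun := F
      map_add' := map_add F
      map_smul' := fun c x => by
        change F (φ c • x) = ψ c • F x
        rw [map_smulₛₗ, ← h]
        rfl }
  exact (LinearEquiv.ofBijective L hF).finrank_eq

lemma exists_complement_of_retraction {R E : Type*} [Ring R] [AddCommGroup E] [Module R E]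
    {S T : Submodule R E} (hTS : T ≤ S) (s : E →ₗ[R] E) (hs : ∀ x ∈ S, s x ∈ T)
    (hT : ∀ x ∈ T, s x = x) : ∃ M ≤ S, T ⊔ M = S ∧ T ⊓ M = ⊥ := by
  refine ⟨S ⊓ LinearMap.ker s, inf_le_left, le_antisymm (sup_le hTS inf_le_left) ?_, ?_⟩
  · intro x hx
    rw [← add_sub_cancel (s x) x]
    refine Submodule.add_mem_sup (hs x hx) ⟨S.sub_mem hx (hTS (hs x hx)), ?_⟩
    rw [SetLike.mem_coe, LinearMap.mem_ker, map_sub, hT _ (hs x hx), sub_self]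
  · rw [Submodule.eq_bot_iff]
    rintro x ⟨hx, -, hx0⟩
    rw [← hT x hx]
    exact hx0

end RingInvariants

section BlockInflation

/-- Inflation `𝒪_𝔭R(G ⧸ N) → 𝒪_𝔭R(G)`. -/
def inflation (𝒪 : Type*) (K : Type u) {G : Type u} [CommRing 𝒪] [Field K] [Algebra 𝒪 K]
    (𝔭 : Ideal 𝒪) [𝔭.IsPrime] [Group G] (N : Subgroup G) [N.Normal] :
    locCharRing 𝒪 K 𝔭 (G ⧸ N) →+* locCharRing 𝒪 K 𝔭 G where
  toFun f := ⟨fun x => f.1 (QuotientGroup.mk x), comp_mem_locCharRing (QuotientGroup.mk' N) f.2⟩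
  map_one' := rfl
  map_mul' _ _ := rfl
  map_zero' := rfl
  map_add' _ _ := rfl

/-- If `|N|` is prime to `p`, inflation induces an isomorphism of `k`-algebras between the
principal blocks of `kR(G ⧸ N)` and `kR(G)`. -/
lemma exists_blockAlg_equiv {𝒪 : Type*} {K G : Type u} [CommRing 𝒪] [Field K] [CharZero K]
    [Algebra 𝒪 K] {𝔭 : Ideal 𝒪} [𝔭.IsMaximal] [Group G] [Finite G] {p : ℕ} [Fact p.Prime]
    (hp : (p : 𝒪) ∈ 𝔭) (N : Subgroup G) [N.Normal] (hN : Nat.Coprime (Nat.card N) p)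
    (he : eFun p K (1 : G) ∈ locCharRing 𝒪 K 𝔭 G)
    (he' : eFun p K (1 : G ⧸ N) ∈ locCharRing 𝒪 K 𝔭 (G ⧸ N)) :
    ∃ φ : blockAlg 𝒪 K 𝔭 (G ⧸ N) ⟨eFun p K (1 : G ⧸ N), he'⟩ ≃+*
        blockAlg 𝒪 K 𝔭 G ⟨eFun p K (1 : G), he⟩,
      ∀ c, φ (blockScalars 𝒪 K 𝔭 (G ⧸ N) _ c) = blockScalars 𝒪 K 𝔭 G _ c := by
  obtain ⟨r, hrmem, hre, hrmul, hrG, hr1, hrN⟩ := exists_inflation_retraction (K := K) hp N he'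
  set e : locCharRing 𝒪 K 𝔭 G := ⟨eFun p K (1 : G), he⟩ with hedef
  set e' : locCharRing 𝒪 K 𝔭 (G ⧸ N) := ⟨eFun p K (1 : G ⧸ N), he'⟩
  have hee : e * e = e := Subtype.ext (eFun_one_mul_self p K)
  set ι := inflation 𝒪 K 𝔭 N
  have hιe : ι e' * e = e := by
    refine Subtype.ext (funext fun x => ?_)
    change eFun p K (1 : G ⧸ N) (QuotientGroup.mk x) * eFun p K (1 : G) x = eFun p K (1 : G) x
    rw [eFun_one_apply p K x, eFun_one_apply]
    split_ifs with h1 h2 h2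
    · rw [one_mul]
    · rw [mul_zero]
    · exact absurd (h2.map (QuotientGroup.mk' N)) h1
    · rw [mul_zero]
  have hle : blockIdeal 𝒪 K 𝔭 (G ⧸ N) e' ≤ (blockIdeal 𝒪 K 𝔭 G e).comap ι := by
    refine sup_le (Ideal.span_le.mpr ?_) (Ideal.span_le.mpr ?_)
    · rintro f ⟨a, ha, hf⟩
      refine Ideal.mem_sup_left (Ideal.subset_span ⟨a, ha, ?_⟩)
      funext x
      exact congrFun hf (QuotientGroup.mk x)
    · rintro _ rfl
      refine Ideal.mem_sup_right (Ideal.mem_span_singleton.mpr ⟨ι (1 - e'), ?_⟩)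
      rw [map_sub, map_one]
      linear_combination -hιe
  have hr_block : ∀ b ∈ blockIdeal 𝒪 K 𝔭 G e,
      (⟨r b.1, hrmem _ b.2⟩ : locCharRing 𝒪 K 𝔭 (G ⧸ N)) ∈ pConstIdeal 𝒪 K 𝔭 (G ⧸ N) := by
    let ρ : locCharRing 𝒪 K 𝔭 G →+ locCharRing 𝒪 K 𝔭 (G ⧸ N) :=
      { toFun := fun b => ⟨r b.1, hrmem _ b.2⟩
        map_zero' := Subtype.ext (map_zero r)
        map_add' := fun a b => Subtype.ext (map_add r _ _) }
    have h1 : ∀ b ∈ pConstIdeal 𝒪 K 𝔭 G, ρ b ∈ pConstIdeal 𝒪 K 𝔭 (G ⧸ N) := by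
      intro b hb
      induction hb using Submodule.closure_induction with
      | zero => rw [map_zero]; exact Ideal.zero_mem _
      | add x y _ _ hx hy => rw [map_add]; exact Ideal.add_mem _ hx hy
      | smul_mem c f hf =>
        obtain ⟨a, ha, hf⟩ := hf
        have : ρ (c • f) = ρ c * constRingHom 𝒪 K 𝔭 (G ⧸ N) a := by
          refine Subtype.ext ?_
          change r (c.1 * f.1) = r c.1 * Function.const _ _
          have h2 : c.1 * f.1 = algebraMap 𝒪 K a • c.1 := by
            rw [hf]; funext x; exact mul_comm _ _
          rw [h2, map_smul]
          funext x
          exact mul_comm _ _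
        rw [this]
        exact Ideal.mul_mem_left _ _ (Ideal.subset_span ⟨a, ha, rfl⟩)
    intro b hb
    obtain ⟨x, hx, y, hy, rfl⟩ := Submodule.mem_sup.mp hb
    obtain ⟨z, rfl⟩ := Ideal.mem_span_singleton.mp hy
    have h3 : ρ ((1 - e) * z) = 0 := by
      refine Subtype.ext ?_
      change r ((1 - e.1) * z.1) = 0
      rw [← hrG, show (1 - e.1) * z.1 * eFun p K (1 : G) = (e.1 - e.1 * e.1) * z.1 from by
        rw [hedef]; ring, show e.1 * e.1 = e.1 from congrArg Subtype.val hee, sub_self, zero_mul,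
        map_zero]
    change ρ (x + (1 - e) * z) ∈ _
    rw [map_add, h3, add_zero]
    exact h1 x hx
  have hge : (blockIdeal 𝒪 K 𝔭 G e).comap ι ≤ blockIdeal 𝒪 K 𝔭 (G ⧸ N) e' := by
    intro a ha
    have h1 := hr_block (ι a) ha
    have h2 : (⟨r (ι a).1, hrmem _ (ι a).2⟩ : locCharRing 𝒪 K 𝔭 (G ⧸ N)) = a * e' := by
      refine Subtype.ext ?_
      change r (fun x => a.1 (QuotientGroup.mk x)) = a.1 * eFun p K 1
      rw [← hr1, ← hrmul, mul_one]
    rw [h2] at h1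
    have h3 : a = a * e' + (1 - e') * a := by ring
    rw [h3]
    exact Ideal.add_mem _ (Ideal.mem_sup_left h1)
      (Ideal.mem_sup_right (Ideal.mem_span_singleton.mpr ⟨a, rfl⟩))
  let Φ := Ideal.quotientMap (blockIdeal 𝒪 K 𝔭 G e) ι hle
  have hΦ : Function.Bijective Φ := by
    refine ⟨Ideal.quotientMap_injective' hge, fun y => ?_⟩
    obtain ⟨b, rfl⟩ := Ideal.Quotient.mk_surjective y
    refine ⟨Ideal.Quotient.mk _ ⟨r b.1, hrmem _ b.2⟩, ?_⟩
    rw [Ideal.quotientMap_mk, Ideal.Quotient.eq]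
    have h4 : ι ⟨r b.1, hrmem _ b.2⟩ * e = b * e := Subtype.ext (hrN hN b.1 b.2)
    refine Ideal.mem_sup_right (Ideal.mem_span_singleton.mpr ⟨ι ⟨r b.1, hrmem _ b.2⟩ - b, ?_⟩)
    linear_combination h4
  refine ⟨RingEquiv.ofBijective Φ hΦ, fun c => ?_⟩
  obtain ⟨a, rfl⟩ := Ideal.Quotient.mk_surjective c
  rfl

end BlockInflation

variable {𝒪 : Type*} [CommRing 𝒪] [IsDomain 𝒪] [IsDedekindDomain 𝒪] [CharZero 𝒪]
variable {K : Type u} [Field K] [Algebra 𝒪 K] [IsFractionRing 𝒪 K]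
variable {𝔭 : Ideal 𝒪} [𝔭.IsMaximal]

set_option maxHeartbeats 2000000 in
set_option synthInstance.maxHeartbeats 1000000 in
/-- Let `N ⊴ G` and `π : G → G/N` the canonical surjection.  The map
`Res_π^{(1)} : R_𝔭(G/N,1) → R_𝔭(G,1)`, `f ↦ (f ∘ π)·e_1^G` is (a) a split injection of
`𝒪_𝔭`-modules, and (b) an isomorphism of `𝒪_𝔭`-algebras when `|N|` is prime to `p`, in
which case `ℓ_p(G,1) = ℓ_p(G/N,1)` and `ext_p^1(G,1) = ext_p^1(G/N,1)`. -/
theorem principal_block_inflation_from_quotient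
    (p : ℕ) [Fact p.Prime] (hp : (p : 𝒪) ∈ 𝔭)
    {G : Type u} [Group G] [Finite G]
    (ζ : K) (hζ : IsPrimitiveRoot ζ (Nat.card G))
    (N : Subgroup G) [N.Normal]
    (he1G : eFun p K (1 : G) ∈ locCharRing 𝒪 K 𝔭 G)
    (he1Q : eFun p K (1 : G ⧸ N) ∈ locCharRing 𝒪 K 𝔭 (G ⧸ N)) :
    (∀ f : (G ⧸ N) → K, f ∈ locCharRing 𝒪 K 𝔭 (G ⧸ N) → f * eFun p K (1 : G ⧸ N) = f →
        (fun x : G => f (QuotientGroup.mk x)) * eFun p K (1 : G) ∈ locCharRing 𝒪 K 𝔭 G) ∧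
    (∀ f₁ f₂ : (G ⧸ N) → K,
        f₁ ∈ locCharRing 𝒪 K 𝔭 (G ⧸ N) → f₁ * eFun p K (1 : G ⧸ N) = f₁ →
        f₂ ∈ locCharRing 𝒪 K 𝔭 (G ⧸ N) → f₂ * eFun p K (1 : G ⧸ N) = f₂ →
        (fun x : G => f₁ (QuotientGroup.mk x)) * eFun p K (1 : G) =
          (fun x : G => f₂ (QuotientGroup.mk x)) * eFun p K (1 : G) → f₁ = f₂) ∧
    (∀ f₁ f₂ : (G ⧸ N) → K,
        ((fun x : G => (f₁ * f₂) (QuotientGroup.mk x)) * eFun p K (1 : G)) =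
          ((fun x : G => f₁ (QuotientGroup.mk x)) * eFun p K (1 : G)) *
            ((fun x : G => f₂ (QuotientGroup.mk x)) * eFun p K (1 : G))) ∧
    ((fun x : G => eFun p K (1 : G ⧸ N) (QuotientGroup.mk x)) * eFun p K (1 : G) =
        eFun p K (1 : G)) ∧
    (letI := locModule 𝒪 K 𝔭 G
     ∃ M : Submodule (Localization.AtPrime 𝔭) (G → K),
       M ≤ Submodule.span (Localization.AtPrime 𝔭)
           {f : G → K | f ∈ locCharRing 𝒪 K 𝔭 G ∧ f * eFun p K (1 : G) = f} ∧
       Submodule.span (Localization.AtPrime 𝔭)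
           {f : G → K | ∃ u : (G ⧸ N) → K, u ∈ locCharRing 𝒪 K 𝔭 (G ⧸ N) ∧
              u * eFun p K (1 : G ⧸ N) = u ∧
              f = (fun x : G => u (QuotientGroup.mk x)) * eFun p K (1 : G)} ⊔ M =
         Submodule.span (Localization.AtPrime 𝔭)
           {f : G → K | f ∈ locCharRing 𝒪 K 𝔭 G ∧ f * eFun p K (1 : G) = f} ∧
       Submodule.span (Localization.AtPrime 𝔭)
           {f : G → K | ∃ u : (G ⧸ N) → K, u ∈ locCharRing 𝒪 K 𝔭 (G ⧸ N) ∧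
              u * eFun p K (1 : G ⧸ N) = u ∧
              f = (fun x : G => u (QuotientGroup.mk x)) * eFun p K (1 : G)} ⊓ M = ⊥) ∧
    (Nat.Coprime (Nat.card N) p →
      (∀ f : G → K, f ∈ locCharRing 𝒪 K 𝔭 G → f * eFun p K (1 : G) = f →
          ∃ u : (G ⧸ N) → K, u ∈ locCharRing 𝒪 K 𝔭 (G ⧸ N) ∧
            u * eFun p K (1 : G ⧸ N) = u ∧
            (fun x : G => u (QuotientGroup.mk x)) * eFun p K (1 : G) = f) ∧
      loewyLength (blockAlg 𝒪 K 𝔭 G ⟨eFun p K (1 : G), he1G⟩) =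
        loewyLength (blockAlg 𝒪 K 𝔭 (G ⧸ N) ⟨eFun p K (1 : G ⧸ N), he1Q⟩) ∧
      extDim (𝒪 ⧸ 𝔭) (blockScalars 𝒪 K 𝔭 G ⟨eFun p K (1 : G), he1G⟩) =
        extDim (𝒪 ⧸ 𝔭) (blockScalars 𝒪 K 𝔭 (G ⧸ N) ⟨eFun p K (1 : G ⧸ N), he1Q⟩)) := by
  have : CharZero K := IsFractionRing.charZero_of_isFractionRing 𝒪
  obtain ⟨r, hrmem, hre, hrmul, hrG, hr1, hrN⟩ := exists_inflation_retraction (K := K) hp N he1Q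
  have hretr : ∀ u : G ⧸ N → K, u * eFun p K (1 : G ⧸ N) = u →
      r ((fun x : G => u (QuotientGroup.mk x)) * eFun p K (1 : G)) = u := by
    intro u hu
    rw [hrG, ← mul_one (fun x : G => u (QuotientGroup.mk x)), hrmul, hr1, hu]
  have hinfl : ∀ u ∈ locCharRing 𝒪 K 𝔭 (G ⧸ N),
      (fun x : G => u (QuotientGroup.mk x)) * eFun p K (1 : G) ∈ locCharRing 𝒪 K 𝔭 G :=
    fun u hu => Subring.mul_mem _ (comp_mem_locCharRing (QuotientGroup.mk' N) hu) he1G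
  refine ⟨fun f hf _ => hinfl f hf, fun f₁ f₂ _ h₁ _ h₂ h => ?_, fun f₁ f₂ => ?_, ?_, ?_,
    fun hN => ⟨fun f hf hfe => ⟨r f, hrmem f hf, hre f, ?_⟩, ?_⟩⟩
  · rw [← hretr f₁ h₁, h, hretr f₂ h₂]
  · rw [mul_mul_mul_comm, eFun_one_mul_self]
    rfl
  · funext x
    simp only [Pi.mul_apply, eFun_one_apply]
    split_ifs with h1 h2 h2
    · rw [one_mul]
    · rw [mul_zero]
    · exact absurd (h2.map (QuotientGroup.mk' N)) h1
    · rw [mul_zero]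
  · let _ := locModule 𝒪 K 𝔭 G
    let s : (G → K) →ₗ[Localization.AtPrime 𝔭] (G → K) :=
      { toFun := fun f => (fun x : G => r f (QuotientGroup.mk x)) * eFun p K (1 : G)
        map_add' := fun f g => by
          rw [map_add]
          funext x
          exact add_mul _ _ _
        map_smul' := fun a f => by
          change (fun x : G => r (locToK 𝒪 K 𝔭 a • f) (QuotientGroup.mk x)) * eFun p K (1 : G) =
            locToK 𝒪 K 𝔭 a • ((fun x : G => r f (QuotientGroup.mk x)) * eFun p K (1 : G))
          rw [map_smul]
          funext x
          exact mul_assoc _ _ _ }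
    refine exists_complement_of_retraction (Submodule.span_le.mpr ?_) s (fun x hx => ?_)
      (fun x hx => ?_)
    · rintro _ ⟨u, hu, -, rfl⟩
      refine Submodule.subset_span ⟨hinfl u hu, ?_⟩
      rw [mul_assoc, eFun_one_mul_self]
    · refine Submodule.mem_comap.mp (Submodule.span_le.mpr ?_ hx)
      rintro f ⟨hf, -⟩
      exact Submodule.subset_span ⟨r f, hrmem f hf, hre f, rfl⟩
    · refine (Submodule.span_le (p := LinearMap.eqLocus s LinearMap.id)).mpr ?_ hx
      rintro _ ⟨u, -, hue, rfl⟩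
      change (fun x : G => r ((fun x : G => u (QuotientGroup.mk x)) * eFun p K (1 : G))
        (QuotientGroup.mk x)) * eFun p K (1 : G) = _
      rw [hretr u hue]
      rfl
  · rw [hrN hN f hf, hfe]
  · obtain ⟨φ, hφ⟩ := exists_blockAlg_equiv (K := K) hp N hN he1G he1Q
    exact ⟨(loewyLength_congr φ).symm, (extDim_congr φ hφ).symm⟩
end

section
/- Let k be a perfect field and let A and B be finite-dimensional associative unital k-algebras. Then: (a) Rad(A ⊗_k B) = A ⊗_k (Rad B) + (Rad A) ⊗_k B; (b) if the quotients satisfy A/Rad A ≅ k and B/Rad B ≅ k, then there is an isomorphism of k-vector spaces Rad(A ⊗_k B)/Rad(A ⊗_k B)² ≅ (Rad A)/(Rad A)² ⊕ (Rad B)/(Rad B)². -/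
open scoped TensorProduct

/-- The Jacobson radical of a finite-dimensional `k`-algebra `A`, viewed as a `k`-submodule
of `A`. -/
noncomputable def radk (k : Type*) [CommRing k] (A : Type*) [Ring A] [Algebra k A] :
    Submodule k A :=
  ((⊥ : Ideal A).jacobson).restrictScalars k

/-- `Rad A / (Rad A)²` as a `k`-vector space. -/
noncomputable abbrev radModk (k : Type*) [CommRing k] (A : Type*) [Ring A] [Algebra k A] :=
  radk k A ⧸ (Submodule.comap (radk k A).subtype (radk k A * radk k A))

theorem Ring.mem_jacobson_of_forall_isNilpotent_mul {R : Type*} [Ring R] {x : R}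
    (h : ∀ y, IsNilpotent (y * x)) : x ∈ Ring.jacobson R := by
  rw [← Ideal.jacobson_bot, Ideal.mem_jacobson_iff]
  intro y
  obtain ⟨u, hu⟩ := (h y).isUnit_one_add
  refine ⟨↑u⁻¹, ?_⟩
  rw [Ideal.mem_bot, sub_eq_zero, mul_assoc, add_comm]
  nth_rewrite 1 [← mul_one (↑u⁻¹ : R)]
  rw [← mul_add, ← hu, Units.inv_mul]

theorem Ring.mem_jacobson_iff_forall_isNilpotent_mul {R : Type*} [Ring R] [IsArtinianRing R]
    {x : R} : x ∈ Ring.jacobson R ↔ ∀ y, IsNilpotent (y * x) := by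
  refine ⟨fun hx y ↦ ?_, Ring.mem_jacobson_of_forall_isNilpotent_mul⟩
  obtain ⟨n, hn⟩ := IsSemiprimaryRing.isNilpotent (R := R)
  refine ⟨n, ?_⟩
  have := Ideal.pow_mem_pow (Ideal.mul_mem_left _ y hx) n
  rwa [hn] at this

theorem RingHom.mem_jacobson_of_injective {R S : Type*} [Ring R] [Ring S] [IsArtinianRing S]
    {f : R →+* S} (hf : Function.Injective f) {x : R} (hx : f x ∈ Ring.jacobson S) :
    x ∈ Ring.jacobson R :=
  Ring.mem_jacobson_of_forall_isNilpotent_mul fun y ↦ by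
    rw [← IsNilpotent.map_iff hf, map_mul]
    exact Ring.mem_jacobson_iff_forall_isNilpotent_mul.mp hx _

section Radk

variable {k A B : Type*} [Field k] [Ring A] [Ring B] [Algebra k A] [Algebra k B]

theorem mem_radk {x : A} : x ∈ radk k A ↔ x ∈ Ring.jacobson A := by
  rw [radk, Submodule.restrictScalars_mem, Ideal.jacobson_bot]

theorem isNilpotent_radk [FiniteDimensional k A] : IsNilpotent (radk k A) := by
  have := IsArtinianRing.of_finite k A
  obtain ⟨n, hn⟩ := IsSemiprimaryRing.isNilpotent (R := A)
  refine ⟨n + 1, ?_⟩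
  have key (m : ℕ) : ∀ x ∈ radk k A ^ (m + 1), x ∈ Ring.jacobson A ^ (m + 1) := by
    induction m with
    | zero => simp [mem_radk, Submodule.pow_one]
    | succ m ih =>
      intro x hx
      rw [pow_succ] at hx
      rw [Submodule.pow_succ]
      exact Submodule.mul_induction_on hx
        (fun a ha b hb ↦ Ideal.mul_mem_mul (ih a ha) (mem_radk.mp hb)) fun a b ↦ add_mem
  refine (Submodule.eq_bot_iff _).mpr fun x hx ↦ ?_
  have := key n x hx
  rwa [Submodule.pow_succ, hn, zero_mul] at this

theorem tmul_mem_radk_right [FiniteDimensional k B] (a : A) {b : B} (hb : b ∈ radk k B) :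
    a ⊗ₜ[k] b ∈ radk k (A ⊗[k] B) := by
  rw [mem_radk]
  refine Ring.mem_jacobson_of_forall_isNilpotent_mul fun y ↦ ?_
  let T : Submodule k (A ⊗[k] B) :=
    (⊤ : Submodule k A).map (Algebra.TensorProduct.includeLeft : A →ₐ[k] A ⊗[k] B).toLinearMap
  let R : Submodule k (A ⊗[k] B) :=
    (radk k B).map (Algebra.TensorProduct.includeRight : B →ₐ[k] A ⊗[k] B).toLinearMap
  have hTR (a : A) {b : B} (hb : b ∈ radk k B) : a ⊗ₜ[k] b ∈ T * R := by
    have := Submodule.mul_mem_mul (M := T) (N := R)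
      (Submodule.mem_map_of_mem (Submodule.mem_top (x := a))) (Submodule.mem_map_of_mem hb)
    simpa using this
  have hcomm : Commute T R := by
    refine le_antisymm ?_ ?_ <;> rw [Submodule.mul_le]
    · rintro _ ⟨a, -, rfl⟩ _ ⟨b, hb, rfl⟩
      have := Submodule.mul_mem_mul (M := R) (N := T)
        (Submodule.mem_map_of_mem hb) (Submodule.mem_map_of_mem (Submodule.mem_top (x := a)))
      simpa using this
    · rintro _ ⟨b, hb, rfl⟩ _ ⟨a, -, rfl⟩
      simpa using hTR a hb
  have hy : y * (a ⊗ₜ[k] b) ∈ T * R := by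
    induction y with
    | zero => simp
    | tmul c d =>
      rw [Algebra.TensorProduct.tmul_mul_tmul]
      exact hTR _ (mem_radk.mpr (Ideal.mul_mem_left _ d (mem_radk.mp hb)))
    | add x y hx hy => rw [add_mul]; exact add_mem hx hy
  obtain ⟨n, hn⟩ := isNilpotent_radk (k := k) (A := B)
  refine ⟨n, ?_⟩
  have hR : R ^ n = 0 := by rw [← Submodule.map_pow, hn]; exact Submodule.map_bot _
  have := Submodule.pow_mem_pow _ hy n
  rwa [hcomm.mul_pow, hR, mul_zero] at this

theorem map_mem_radk {f : A →ₐ[k] B} (hf : Function.Surjective f) {x : A} (hx : x ∈ radk k A) :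
    f x ∈ radk k B := by
  have : RingHomSurjective (f : A →+* B) := ⟨hf⟩
  exact mem_radk.mpr (Ring.le_comap_jacobson (f : A →+* B) (mem_radk.mp hx))

theorem tmul_mem_radk_left [FiniteDimensional k A] {a : A} (ha : a ∈ radk k A) (b : B) :
    a ⊗ₜ[k] b ∈ radk k (A ⊗[k] B) :=
  map_mem_radk (Algebra.TensorProduct.comm k B A).surjective (tmul_mem_radk_right b ha)

end Radk

section Descent

variable {k L A : Type*} [Field k] [Field L] [Algebra k L]

theorem Submodule.exists_one_tmul_mem_of_isGalois [IsGalois k L] [AddCommGroup A] [Module k A]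
    {W : Submodule L (L ⊗[k] A)} (hW : W ≠ ⊥)
    (hinv : ∀ σ : L ≃ₐ[k] L, ∀ w ∈ W, σ.toLinearMap.rTensor A w ∈ W) :
    ∃ a : A, a ≠ 0 ∧ (1 : L) ⊗ₜ[k] a ∈ W := by
  let b := Module.Basis.ofVectorSpace k A
  let c := b.baseChange L
  have hσ (σ : L ≃ₐ[k] L) (w : L ⊗[k] A) (i) :
      c.repr (σ.toLinearMap.rTensor A w) i = σ (c.repr w i) := by
    induction w with
    | zero => simp
    | tmul x a => simp [c]
    | add x y hx hy => simp [hx, hy]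
  obtain ⟨w, ⟨hwW, hw0⟩, hmin⟩ := WellFounded.has_min
    (measure fun w : L ⊗[k] A ↦ (c.repr w).support.card).wf {w | w ∈ W ∧ w ≠ 0}
    (Submodule.exists_mem_ne_zero_of_ne_bot hW)
  obtain ⟨i, hi⟩ : ∃ i, c.repr w i ≠ 0 := by
    by_contra! h
    exact hw0 (c.repr.map_eq_zero_iff.mp (Finsupp.ext h))
  let v := (c.repr w i)⁻¹ • w
  have hvW : v ∈ W := W.smul_mem _ hwW
  have hvi : c.repr v i = 1 := by simp [v, hi]
  have hfix (σ : L ≃ₐ[k] L) : σ.toLinearMap.rTensor A v = v := by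
    by_contra hne
    refine hmin _ ⟨W.sub_mem (hinv σ v hvW) hvW, sub_ne_zero.mpr hne⟩ ?_
    refine Finset.card_lt_card (Finset.ssubset_iff_of_subset ?_ |>.mpr ⟨i, ?_, ?_⟩)
    · intro j hj
      rw [Finsupp.mem_support_iff, map_sub, Finsupp.sub_apply, hσ] at hj
      rw [Finsupp.mem_support_iff]
      contrapose! hj
      simp [v, hj]
    · simpa using hi
    · simp [hσ, hvi]
  have hrange (j) : ∃ x : k, algebraMap k L x = c.repr v j :=
    (InfiniteGalois.mem_range_algebraMap_iff_fixed _).mpr fun σ ↦ by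
      rw [← hσ σ v j, hfix]
  choose x hx using hrange
  have hv : v = (1 : L) ⊗ₜ[k] ∑ j ∈ (c.repr v).support, x j • b j := by
    conv_lhs => rw [← c.linearCombination_repr v, Finsupp.linearCombination_apply, Finsupp.sum]
    rw [TensorProduct.tmul_sum]
    refine Finset.sum_congr rfl fun j _ ↦ ?_
    rw [← hx, Module.Basis.baseChange_apply, TensorProduct.tmul_smul, algebraMap_smul]
  refine ⟨_, fun h0 ↦ ?_, hv ▸ hvW⟩
  rw [h0, TensorProduct.tmul_zero] at hv
  simp [hv] at hvi

theorem IsSemisimpleRing.baseChange_of_isGalois [IsGalois k L] [Ring A] [Algebra k A]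
    [FiniteDimensional k A] [IsSemisimpleRing A] : IsSemisimpleRing (L ⊗[k] A) := by
  have := IsArtinianRing.of_finite L (L ⊗[k] A)
  rw [IsArtinianRing.isSemisimpleRing_iff_jacobson]
  by_contra hne
  obtain ⟨a, ha, haW⟩ := Submodule.exists_one_tmul_mem_of_isGalois
    (W := (Ring.jacobson (L ⊗[k] A)).restrictScalars L) (by simpa using hne) fun σ w hw ↦ by
      let f : L ⊗[k] A ≃ₐ[k] L ⊗[k] A := Algebra.TensorProduct.congr σ AlgEquiv.refl
      exact mem_radk.mp
        (map_mem_radk (f := f.toAlgHom) f.surjective (mem_radk (k := k).mpr hw))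
  have := RingHom.mem_jacobson_of_injective
    (f := (Algebra.TensorProduct.includeRight : A →ₐ[k] L ⊗[k] A).toRingHom)
    (Algebra.TensorProduct.includeRight_injective (algebraMap k L).injective) haW
  rw [IsSemisimpleRing.jacobson_eq_bot] at this
  exact ha this

end Descent

section Perfect

variable (k A B : Type*) [Field k] [PerfectField k] [Ring A] [Ring B] [Algebra k A] [Algebra k B]
  [FiniteDimensional k A] [FiniteDimensional k B]

theorem IsSemisimpleRing.tensorProduct_of_perfectField [IsSemisimpleRing A] [IsSemisimpleRing B] :
    IsSemisimpleRing (A ⊗[k] B) := by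
  let L := AlgebraicClosure k
  have : IsGalois k L := {}
  have : IsSemisimpleRing (L ⊗[k] A) := .baseChange_of_isGalois
  have : IsSemisimpleRing (L ⊗[k] B) := .baseChange_of_isGalois
  obtain ⟨n, d, -, ⟨e⟩⟩ :=
    IsSemisimpleRing.exists_algEquiv_pi_matrix_of_isAlgClosed L (L ⊗[k] A)
  let e' : L ⊗[k] (A ⊗[k] B) ≃ₐ[k]
      Π i, Matrix (Unit × Fin (d i)) (Unit × Fin (d i)) (B ⊗[k] L) :=
    (Algebra.TensorProduct.assoc k k k L A B).symm.trans <|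
    (Algebra.TensorProduct.comm k _ B).trans <|
    (Algebra.TensorProduct.congr AlgEquiv.refl (e.restrictScalars k)).trans <|
    (Algebra.TensorProduct.piRight k k B _).trans <|
    AlgEquiv.piCongrRight fun i ↦
      (Algebra.TensorProduct.congr (Matrix.uniqueAlgEquiv (m := Unit)).symm AlgEquiv.refl).trans <|
      Matrix.kroneckerTMulAlgEquiv Unit (Fin (d i)) k k B L
  have : IsSemisimpleRing (B ⊗[k] L) :=
    (Algebra.TensorProduct.comm k L B).toRingEquiv.isSemisimpleRing
  have : IsSemisimpleRing (L ⊗[k] (A ⊗[k] B)) := e'.symm.toRingEquiv.isSemisimpleRing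
  have := IsArtinianRing.of_finite k (A ⊗[k] B)
  rw [IsArtinianRing.isSemisimpleRing_iff_jacobson, eq_bot_iff]
  intro x hx
  have h := mem_radk.mp (tmul_mem_radk_right (1 : L) (mem_radk (k := k).mpr hx))
  rw [IsSemisimpleRing.jacobson_eq_bot, Ideal.mem_bot] at h
  exact Algebra.TensorProduct.includeRight_injective (algebraMap k L).injective
    (h.trans (map_zero (Algebra.TensorProduct.includeRight : _ →ₐ[k] L ⊗[k] (A ⊗[k] B))).symm)

theorem radk_tensorProduct :
    radk k (A ⊗[k] B) =
      LinearMap.range (TensorProduct.map (LinearMap.id : A →ₗ[k] A) (radk k B).subtype) ⊔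
      LinearMap.range (TensorProduct.map (radk k A).subtype (LinearMap.id : B →ₗ[k] B)) := by
  refine le_antisymm ?_ (sup_le ?_ ?_)
  · let p := Ideal.Quotient.mkₐ k (Ring.jacobson A)
    let q := Ideal.Quotient.mkₐ k (Ring.jacobson B)
    have hp : Function.Surjective p := Ideal.Quotient.mkₐ_surjective k _
    have hq : Function.Surjective q := Ideal.Quotient.mkₐ_surjective k _
    have hpe : Function.Exact (radk k A).subtype p.toLinearMap := fun x ↦ by
      simp [p, mem_radk, Ideal.Quotient.eq_zero_iff_mem]
    have hqe : Function.Exact (radk k B).subtype q.toLinearMap := fun x ↦ by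
      simp [q, mem_radk, Ideal.Quotient.eq_zero_iff_mem]
    have : FiniteDimensional k (A ⧸ Ring.jacobson A) := .of_surjective p.toLinearMap hp
    have : FiniteDimensional k (B ⧸ Ring.jacobson B) := .of_surjective q.toLinearMap hq
    have := IsArtinianRing.of_finite k A
    have := IsArtinianRing.of_finite k B
    have := IsSemisimpleRing.tensorProduct_of_perfectField k
      (A ⧸ Ring.jacobson A) (B ⧸ Ring.jacobson B)
    intro x hx
    have h := mem_radk.mp (map_mem_radk (f := Algebra.TensorProduct.map p q)
      (TensorProduct.map_surjective hp hq) hx)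
    have h' : x ∈ LinearMap.ker (TensorProduct.map p.toLinearMap q.toLinearMap) :=
      (IsSemisimpleRing.jacobson_eq_bot ((A ⧸ Ring.jacobson A) ⊗[k] (B ⧸ Ring.jacobson B))).le h
    rwa [TensorProduct.map_ker hpe hp hqe hq] at h'
  · rintro _ ⟨x, rfl⟩
    induction x with
    | zero => simp
    | tmul a b => exact tmul_mem_radk_right a b.2
    | add x y hx hy => rw [map_add]; exact add_mem hx hy
  · rintro _ ⟨x, rfl⟩
    induction x with
    | zero => simp
    | tmul a b => exact tmul_mem_radk_left a.2 b
    | add x y hx hy => rw [map_add]; exact add_mem hx hy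

end Perfect

section RadModk

variable {k A B C : Type*} [Field k] [Ring A] [Ring B] [Ring C] [Algebra k A] [Algebra k B]
  [Algebra k C]

/-- The linear map `Rad A / (Rad A)² → Rad B / (Rad B)²` induced by an algebra homomorphism
`A → B` mapping `Rad A` into `Rad B`. -/
noncomputable def radModk.map (f : A →ₐ[k] B) (hf : ∀ x ∈ radk k A, f x ∈ radk k B) :
    radModk k A →ₗ[k] radModk k B :=
  Submodule.mapQ _ _ (f.toLinearMap.restrict hf) fun x hx ↦ by
    have h : radk k A * radk k A ≤ (radk k B * radk k B).comap f.toLinearMap :=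
      Submodule.mul_le.mpr fun a ha b hb ↦ by
        simpa using Submodule.mul_mem_mul (hf a ha) (hf b hb)
    exact h hx

@[simp]
theorem radModk.map_mk (f : A →ₐ[k] B) (hf : ∀ x ∈ radk k A, f x ∈ radk k B) (x : radk k A) :
    radModk.map f hf (Submodule.Quotient.mk x) = Submodule.Quotient.mk ⟨f x, hf x x.2⟩ :=
  rfl

theorem radModk.mk_eq_mk_iff {x y : radk k A} :
    (Submodule.Quotient.mk x : radModk k A) = Submodule.Quotient.mk y ↔
      (x - y : A) ∈ radk k A * radk k A := by
  rw [Submodule.Quotient.eq]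
  rfl

theorem exists_algHom_forall_eq_zero_iff_mem_radk
    (h : Module.finrank k (A ⧸ radk k A) = 1) :
    ∃ ε : A →ₐ[k] k, ∀ x, ε x = 0 ↔ x ∈ radk k A := by
  let e : (A ⧸ radk k A) ≃ₗ[k] A ⧸ Ring.jacobson A :=
    Submodule.Quotient.equiv _ ((Ring.jacobson A).restrictScalars k) (LinearEquiv.refl k A)
      (by ext; simp [mem_radk])
  rw [e.finrank_eq] at h
  let i : k ≃ₐ[k] A ⧸ Ring.jacobson A := AlgEquiv.ofBijective (Algebra.ofId k _)
    (Module.Free.bijective_algebraMap_of_finrank_eq_one h)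
  refine ⟨i.symm.toAlgHom.comp (Ideal.Quotient.mkₐ k _), fun x ↦ ?_⟩
  simp [mem_radk, Ideal.Quotient.eq_zero_iff_mem]

end RadModk

theorem nonempty_radModk_tensorProduct_equiv (k A B : Type*) [Field k] [PerfectField k]
    [Ring A] [Ring B] [Algebra k A] [Algebra k B] [FiniteDimensional k A] [FiniteDimensional k B]
    (hA : Module.finrank k (A ⧸ radk k A) = 1) (hB : Module.finrank k (B ⧸ radk k B) = 1) :
    Nonempty (radModk k (A ⊗[k] B) ≃ₗ[k] (radModk k A × radModk k B)) := by
  obtain ⟨εA, hεA⟩ := exists_algHom_forall_eq_zero_iff_mem_radk hA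
  obtain ⟨εB, hεB⟩ := exists_algHom_forall_eq_zero_iff_mem_radk hB
  have hsA (a : A) : a - algebraMap k A (εA a) ∈ radk k A := by simp [← hεA]
  have hsB (b : B) : b - algebraMap k B (εB b) ∈ radk k B := by simp [← hεB]
  let jA : A →ₐ[k] A ⊗[k] B := Algebra.TensorProduct.includeLeft
  let jB : B →ₐ[k] A ⊗[k] B := Algebra.TensorProduct.includeRight
  let πA : A ⊗[k] B →ₐ[k] A :=
    Algebra.TensorProduct.lift (AlgHom.id k A) ((Algebra.ofId k A).comp εB)
      fun a b ↦ (Algebra.commutes (εB b) a).symm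
  let πB : A ⊗[k] B →ₐ[k] B :=
    Algebra.TensorProduct.lift ((Algebra.ofId k B).comp εA) (AlgHom.id k B)
      fun a b ↦ Algebra.commutes (εA a) b
  have hπA_tmul (a : A) (b : B) : πA (a ⊗ₜ b) = a * algebraMap k A (εB b) :=
    Algebra.TensorProduct.lift_tmul ..
  have hπB_tmul (a : A) (b : B) : πB (a ⊗ₜ b) = algebraMap k B (εA a) * b :=
    Algebra.TensorProduct.lift_tmul ..
  have hjA : ∀ a ∈ radk k A, jA a ∈ radk k (A ⊗[k] B) := fun a ha ↦ tmul_mem_radk_left ha 1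
  have hjB : ∀ b ∈ radk k B, jB b ∈ radk k (A ⊗[k] B) := fun b hb ↦ tmul_mem_radk_right 1 hb
  have hπA : ∀ x ∈ radk k (A ⊗[k] B), πA x ∈ radk k A := fun x hx ↦
    map_mem_radk (fun a ↦ ⟨a ⊗ₜ 1, by simp [hπA_tmul]⟩) hx
  have hπB : ∀ x ∈ radk k (A ⊗[k] B), πB x ∈ radk k B := fun x hx ↦
    map_mem_radk (fun b ↦ ⟨1 ⊗ₜ b, by simp [hπB_tmul]⟩) hx
  let F : radModk k A × radModk k B →ₗ[k] radModk k (A ⊗[k] B) :=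
    (radModk.map jA hjA).coprod (radModk.map jB hjB)
  let G : radModk k (A ⊗[k] B) →ₗ[k] radModk k A × radModk k B :=
    (radModk.map πA hπA).prod (radModk.map πB hπB)
  have hGF : Function.LeftInverse G F := by
    rintro ⟨⟨a⟩, ⟨b⟩⟩
    have ha := (hεA a).mpr a.2
    have hb := (hεB b).mpr b.2
    change G (radModk.map jA hjA (Submodule.Quotient.mk a) +
      radModk.map jB hjB (Submodule.Quotient.mk b)) =
      (Submodule.Quotient.mk a, Submodule.Quotient.mk b)
    rw [radModk.map_mk, radModk.map_mk, ← Submodule.Quotient.mk_add]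
    refine Prod.ext ?_ ?_
    · change radModk.map πA hπA _ = _
      rw [radModk.map_mk, radModk.mk_eq_mk_iff]
      simp [hπA_tmul, jA, jB, hb]
    · change radModk.map πB hπB _ = _
      rw [radModk.map_mk, radModk.mk_eq_mk_iff]
      simp [hπB_tmul, jA, jB, ha]
  let S : Submodule k (A ⊗[k] B) :=
    (radk k A).map jA.toLinearMap ⊔ (radk k B).map jB.toLinearMap ⊔
      radk k (A ⊗[k] B) * radk k (A ⊗[k] B)
  have hS : radk k (A ⊗[k] B) ≤ S := by
    have hmul {a : A} {b : B} (ha : a ∈ radk k A) (hb : b ∈ radk k B) : a ⊗ₜ[k] b ∈ S := by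
      have := Submodule.mul_mem_mul (hjA a ha) (hjB b hb)
      exact Submodule.mem_sup_right (by simpa [jA, jB] using this)
    have hl {a : A} (ha : a ∈ radk k A) : a ⊗ₜ[k] (1 : B) ∈ S :=
      Submodule.mem_sup_left (Submodule.mem_sup_left (Submodule.mem_map_of_mem ha))
    have hr {b : B} (hb : b ∈ radk k B) : (1 : A) ⊗ₜ[k] b ∈ S :=
      Submodule.mem_sup_left (Submodule.mem_sup_right (Submodule.mem_map_of_mem hb))
    rw [radk_tensorProduct]
    refine sup_le ?_ ?_
    · rintro _ ⟨x, rfl⟩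
      induction x with
      | zero => simp
      | tmul a b =>
        have := add_mem (hmul (hsA a) b.2) (S.smul_mem (εA a) (hr b.2))
        simpa [TensorProduct.sub_tmul, Algebra.algebraMap_eq_smul_one, TensorProduct.smul_tmul']
          using this
      | add x y hx hy => rw [map_add]; exact add_mem hx hy
    · rintro _ ⟨x, rfl⟩
      induction x with
      | zero => simp
      | tmul a b =>
        have := add_mem (hmul a.2 (hsB b)) (S.smul_mem (εB b) (hl a.2))
        simpa [TensorProduct.tmul_sub, Algebra.algebraMap_eq_smul_one] using this
      | add x y hx hy => rw [map_add]; exact add_mem hx hy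
  have hF : Function.Surjective F := by
    intro x
    obtain ⟨x, rfl⟩ := Submodule.Quotient.mk_surjective _ x
    obtain ⟨y, hy, z, hz, hx⟩ := Submodule.mem_sup.mp (hS x.2)
    obtain ⟨_, ⟨a, ha, rfl⟩, _, ⟨b, hb, rfl⟩, rfl⟩ := Submodule.mem_sup.mp hy
    refine ⟨(Submodule.Quotient.mk ⟨a, ha⟩, Submodule.Quotient.mk ⟨b, hb⟩), ?_⟩
    rw [LinearMap.coprod_apply, radModk.map_mk, radModk.map_mk, ← Submodule.Quotient.mk_add, eq_comm,
      radModk.mk_eq_mk_iff]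
    simpa [← hx] using hz
  exact ⟨(LinearEquiv.ofBijective F ⟨hGF.injective, hF⟩).symm⟩

set_option maxHeartbeats 1000000 in
set_option synthInstance.maxHeartbeats 400000 in
/-- Let `k` be a perfect field, `A`, `B` finite-dimensional associative
unital `k`-algebras.  Then (a) `Rad(A ⊗ₖ B) = A ⊗ₖ Rad B + Rad A ⊗ₖ B`, and
(b) if `A/Rad A ≅ k` and `B/Rad B ≅ k` then
`Rad(A ⊗ₖ B)/Rad(A ⊗ₖ B)² ≅ Rad A/(Rad A)² ⊕ Rad B/(Rad B)²` as `k`-vector spaces. -/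
theorem radical_of_tensor_product_of_algebras
    (k : Type*) [Field k] [PerfectField k]
    (A B : Type*) [Ring A] [Ring B] [Algebra k A] [Algebra k B]
    [FiniteDimensional k A] [FiniteDimensional k B] :
    (radk k (A ⊗[k] B) =
      LinearMap.range (TensorProduct.map (LinearMap.id : A →ₗ[k] A) (radk k B).subtype) ⊔
      LinearMap.range (TensorProduct.map (radk k A).subtype (LinearMap.id : B →ₗ[k] B))) ∧
    (Module.finrank k (A ⧸ radk k A) = 1 → Module.finrank k (B ⧸ radk k B) = 1 →
      Nonempty (radModk k (A ⊗[k] B) ≃ₗ[k] (radModk k A × radModk k B))) := by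
  exact ⟨radk_tensorProduct k A B, nonempty_radModk_tensorProduct_equiv k A B⟩
end
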